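/- For every real s_L there exist constants C > 0 and N₀ ∈ ℕ (depending only on s_L) such that for all N ≥ N₀, for j ∈ {N−1, N} with u_j = √(2j+1), and for all s ≥ s_L, both |(2N)^{1/4} τ_N² φ_j'(u_j + s τ_N)| ≤ C e^{−s} and |(2N)^{1/4} τ_N² φ_j'(u_j + s τ_N) − Ai'(s)| ≤ C N^{−2/3} e^{−s/2}, where τ_N = 2^{−1/2} N^{−1/6} and φ_j' denotes the derivative of φ_j. -/

import Mathlib

open Real Filter MeasureTheory

/-- Physicists' Hermite polynomial `H_n(x) = (-1)^n e^{x²} (d^n/dx^n) e^{-x²}`. -/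
noncomputable def physHermite (n : ℕ) (x : ℝ) : ℝ :=
  (-1 : ℝ) ^ n * Real.exp (x ^ 2) * iteratedDeriv n (fun t : ℝ => Real.exp (-t ^ 2)) x

/-- Normalizing constant `h_n = √π 2^n n!`. -/
noncomputable def hNorm (n : ℕ) : ℝ := Real.sqrt Real.pi * 2 ^ n * (n.factorial : ℝ)

/-- Oscillator wave function `φ_n(x) = h_n^{-1/2} e^{-x²/2} H_n(x)`. -/
noncomputable def osc (n : ℕ) (x : ℝ) : ℝ :=
  hNorm n ^ (-(1 : ℝ) / 2) * Real.exp (-x ^ 2 / 2) * physHermite n x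

/-- Airy function `Ai(x) = π⁻¹ lim_{R→∞} ∫₀^R cos(t³/3 + xt) dt`. -/
noncomputable def Ai (x : ℝ) : ℝ :=
  Real.pi⁻¹ *
    limUnder Filter.atTop (fun R : ℝ => ∫ t in (0 : ℝ)..R, Real.cos (t ^ 3 / 3 + x * t))

/-- Scaling constant `τ_N = 2^{-1/2} N^{-1/6}`. -/
noncomputable def tauN (N : ℕ) : ℝ := (2 : ℝ) ^ (-(1 : ℝ) / 2) * (N : ℝ) ^ (-(1 : ℝ) / 6)

/-- `Δ_N = (√(2N+1) - √(2N-1))/τ_N`. -/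
noncomputable def DeltaN (N : ℕ) : ℝ :=
  (Real.sqrt (2 * N + 1) - Real.sqrt (2 * N - 1)) / tauN N

open Topology

/-! ### Exponential moments along a vertical line -/

/-- The integral of `w ^ k Φ e^{-w x}` over the vertical line `w = b + i v`. -/
noncomputable def lineMoment (b : ℝ) (Φ : ℝ → ℂ) (k : ℕ) (x : ℝ) : ℂ :=
  ∫ v : ℝ, ((b : ℂ) + v * Complex.I) ^ k * Φ v * Complex.exp (-((b : ℂ) + v * Complex.I) * x)

/-- Powers of `c + v²` are dominated by Gaussians. -/
lemma exists_pow_le_exp_mul_sq (k : ℕ) {c a : ℝ} (hc : 0 ≤ c) (ha : 0 < a) :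
    ∃ K > 0, ∀ v : ℝ, (c + v ^ 2) ^ k ≤ K * Real.exp (a * v ^ 2) := by
  refine ⟨(k.factorial : ℝ) / a ^ k * Real.exp (a * c), by positivity, fun v => ?_⟩
  have h := Real.pow_div_factorial_le_exp (a * (c + v ^ 2)) (by positivity) k
  rw [div_le_iff₀ (by positivity), mul_pow] at h
  have h2 : Real.exp (a * (c + v ^ 2)) = Real.exp (a * c) * Real.exp (a * v ^ 2) := by
    rw [← Real.exp_add]; ring_nf
  rw [h2] at h
  rw [div_mul_eq_mul_div, div_mul_eq_mul_div, le_div_iff₀ (by positivity)]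
  linarith

lemma norm_line_sq (b v : ℝ) : ‖(b : ℂ) + v * Complex.I‖ ^ 2 = b ^ 2 + v ^ 2 := by
  rw [Complex.sq_norm, Complex.normSq_add_mul_I]

lemma norm_line_pow_le (b v : ℝ) (k : ℕ) :
    ‖(b : ℂ) + v * Complex.I‖ ^ k ≤ ((1 + b ^ 2) + v ^ 2) ^ k := by
  refine pow_le_pow_left₀ (norm_nonneg _) ?_ k
  have := norm_line_sq b v
  nlinarith [sq_nonneg (‖(b : ℂ) + v * Complex.I‖ - 1)]

lemma norm_exp_line (b v x : ℝ) :
    ‖Complex.exp (-((b : ℂ) + v * Complex.I) * x)‖ = Real.exp (-(b * x)) := by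
  rw [Complex.norm_exp]; congr 1; simp

lemma exists_norm_integrand_le {b C a : ℝ} {Φ : ℝ → ℂ} (hC : 0 ≤ C) (ha : 0 < a)
    (hΦ : ∀ v, ‖Φ v‖ ≤ C * Real.exp (-a * v ^ 2)) (k : ℕ) :
    ∃ K > 0, ∀ v x : ℝ, ‖((b : ℂ) + v * Complex.I) ^ k * Φ v *
      Complex.exp (-((b : ℂ) + v * Complex.I) * x)‖ ≤
        K * Real.exp (-(b * x)) * Real.exp (-(a / 2) * v ^ 2) := by
  obtain ⟨K, hK, h⟩ := exists_pow_le_exp_mul_sq k (c := 1 + b ^ 2) (a := a / 2) (by positivity)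
    (by positivity)
  refine ⟨K * (C + 1), by positivity, fun v x => ?_⟩
  rw [norm_mul, norm_mul, norm_pow, norm_exp_line]
  have h1 := (norm_line_pow_le b v k).trans (h v)
  have e : Real.exp (-(a / 2) * v ^ 2) = Real.exp (a / 2 * v ^ 2) * Real.exp (-a * v ^ 2) := by
    rw [← Real.exp_add]; ring_nf
  rw [e]
  have h2 : ‖Φ v‖ ≤ (C + 1) * Real.exp (-a * v ^ 2) :=
    (hΦ v).trans (by gcongr; linarith)
  calc _ ≤ (K * Real.exp (a / 2 * v ^ 2)) * ((C + 1) * Real.exp (-a * v ^ 2))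
        * Real.exp (-(b * x)) := by gcongr
    _ = _ := by ring

section

variable {b C a : ℝ} {Φ : ℝ → ℂ}

lemma continuous_integrand (hc : Continuous Φ) (k : ℕ) (x : ℝ) :
    Continuous fun v : ℝ => ((b : ℂ) + v * Complex.I) ^ k * Φ v *
      Complex.exp (-((b : ℂ) + v * Complex.I) * x) := by fun_prop

lemma integrable_integrand (hc : Continuous Φ) (hC : 0 ≤ C) (ha : 0 < a)
    (hΦ : ∀ v, ‖Φ v‖ ≤ C * Real.exp (-a * v ^ 2)) (k : ℕ) (x : ℝ) :
    Integrable fun v : ℝ => ((b : ℂ) + v * Complex.I) ^ k * Φ v *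
      Complex.exp (-((b : ℂ) + v * Complex.I) * x) := by
  obtain ⟨K, hK, h⟩ := exists_norm_integrand_le (b := b) hC ha hΦ k
  exact ((integrable_exp_neg_mul_sq (half_pos ha)).const_mul
    (K * Real.exp (-(b * x)))).mono' (continuous_integrand hc k x).aestronglyMeasurable
    (Eventually.of_forall fun v => h v x)

lemma exists_norm_lineMoment_le (hC : 0 ≤ C) (ha : 0 < a)
    (hΦ : ∀ v, ‖Φ v‖ ≤ C * Real.exp (-a * v ^ 2)) (k : ℕ) :
    ∃ K > 0, ∀ x, ‖lineMoment b Φ k x‖ ≤ K * Real.exp (-(b * x)) := by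
  obtain ⟨K, hK, h⟩ := exists_norm_integrand_le (b := b) hC ha hΦ k
  refine ⟨K * √(π / (a / 2)), by positivity, fun x => ?_⟩
  refine (norm_integral_le_of_norm_le ((integrable_exp_neg_mul_sq (half_pos ha)).const_mul
    (K * Real.exp (-(b * x)))) (Eventually.of_forall fun v => h v x)).trans (le_of_eq ?_)
  rw [integral_const_mul, integral_gaussian]; ring

lemma hasDerivAt_lineMoment (hc : Continuous Φ) (hC : 0 ≤ C) (ha : 0 < a)
    (hΦ : ∀ v, ‖Φ v‖ ≤ C * Real.exp (-a * v ^ 2)) (k : ℕ) (x : ℝ) :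
    HasDerivAt (lineMoment b Φ k) (-lineMoment b Φ (k + 1) x) x := by
  obtain ⟨K, hK, h⟩ := exists_norm_integrand_le (b := b) hC ha hΦ (k + 1)
  have key := (hasDerivAt_integral_of_dominated_loc_of_deriv_le (𝕜 := ℝ) (μ := volume)
    (x₀ := x) (s := Metric.ball x 1)
    (F := fun x v => ((b : ℂ) + (v : ℝ) * Complex.I) ^ k * Φ v *
      Complex.exp (-((b : ℂ) + v * Complex.I) * x))
    (F' := fun x v => -(((b : ℂ) + (v : ℝ) * Complex.I) ^ (k + 1) * Φ v *
      Complex.exp (-((b : ℂ) + v * Complex.I) * x)))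
    (bound := fun v => K * Real.exp (|b| * (|x| + 1)) * Real.exp (-(a / 2) * v ^ 2))
    (Metric.ball_mem_nhds x one_pos)
    (Eventually.of_forall fun y => (continuous_integrand hc k y).aestronglyMeasurable)
    (integrable_integrand hc hC ha hΦ k x)
    (continuous_integrand hc (k + 1) x).neg.aestronglyMeasurable
    (Eventually.of_forall fun v y hy => ?_)
    ((integrable_exp_neg_mul_sq (half_pos ha)).const_mul _)
    (Eventually.of_forall fun v y _ => ?_)).2
  · rw [integral_neg] at key
    exact key
  · rw [norm_neg]
    refine (h v y).trans ?_
    gcongr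
    have h1 : |y| ≤ |x| + 1 := by
      have h2 : |y - x| < 1 := by simpa [Real.dist_eq] using hy
      have := abs_sub_abs_le_abs_sub y x
      linarith
    calc -(b * y) ≤ |b * y| := neg_le_abs _
      _ = |b| * |y| := abs_mul _ _
      _ ≤ _ := by gcongr
  · have h1 : HasDerivAt (fun y : ℝ => -((b : ℂ) + v * Complex.I) * (y : ℂ))
        (-((b : ℂ) + v * Complex.I) * 1) y :=
      (Complex.ofRealCLM.hasDerivAt (x := y)).const_mul _
    exact (h1.cexp.const_mul (((b : ℂ) + v * Complex.I) ^ k * Φ v)).congr_deriv (by ring)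

end

/-! ### The Airy function -/

/-- The weight `e^{t³/3}` on the line `t = 1 + i v`. -/
noncomputable def airyWeight (v : ℝ) : ℂ :=
  Complex.exp ((((1 : ℝ) : ℂ) + v * Complex.I) ^ 3 / 3)

lemma continuous_airyWeight : Continuous airyWeight := by
  unfold airyWeight; fun_prop

lemma norm_airyWeight (v : ℝ) :
    ‖airyWeight v‖ = Real.exp (1 / 3) * Real.exp (-1 * v ^ 2) := by
  have h : (((1 : ℝ) : ℂ) + v * Complex.I) ^ 3 / 3
      = ((1 / 3 + -1 * v ^ 2 : ℝ) : ℂ) + ((v - v ^ 3 / 3 : ℝ) : ℂ) * Complex.I := by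
    push_cast
    linear_combination (v ^ 2 * (1 + v * Complex.I / 3) : ℂ) * Complex.I_sq
  rw [airyWeight, h, Complex.norm_exp, ← Real.exp_add]
  congr 1
  simp [-Complex.ofReal_add, -Complex.ofReal_sub, -Complex.ofReal_div, -Complex.ofReal_mul,
    -Complex.ofReal_pow, -Complex.ofReal_neg]

lemma norm_airyWeight_le (v : ℝ) :
    ‖airyWeight v‖ ≤ Real.exp (1 / 3) * Real.exp (-1 * v ^ 2) := (norm_airyWeight v).le

/-- The `k`-th exponential moment of `e^{t³/3}` along `Re t = 1`. -/
noncomputable def airyMoment (k : ℕ) (x : ℝ) : ℂ := lineMoment 1 airyWeight k x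

lemma integrable_airy_integrand (k : ℕ) (x : ℝ) :
    Integrable fun v : ℝ => (((1 : ℝ) : ℂ) + v * Complex.I) ^ k * airyWeight v *
      Complex.exp (-(((1 : ℝ) : ℂ) + v * Complex.I) * x) :=
  integrable_integrand continuous_airyWeight (by positivity) one_pos norm_airyWeight_le k x

lemma hasDerivAt_line (b v : ℝ) :
    HasDerivAt (fun v : ℝ => (b : ℂ) + v * Complex.I) Complex.I v := by
  simpa using ((Complex.ofRealCLM.hasDerivAt (x := v)).mul_const Complex.I).const_add (b : ℂ)

/-- Airy's equation, in integrated form. -/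
lemma airyMoment_two (x : ℝ) : airyMoment 2 x = x * airyMoment 0 x := by
  have hd : ∀ v : ℝ, HasDerivAt (fun v : ℝ => (((1 : ℝ) : ℂ) + v * Complex.I) ^ 0 *
      airyWeight v * Complex.exp (-(((1 : ℝ) : ℂ) + v * Complex.I) * x))
      (Complex.I * ((((1 : ℝ) : ℂ) + v * Complex.I) ^ 2 * airyWeight v *
          Complex.exp (-(((1 : ℝ) : ℂ) + v * Complex.I) * x)
        - x * ((((1 : ℝ) : ℂ) + v * Complex.I) ^ 0 * airyWeight v *
          Complex.exp (-(((1 : ℝ) : ℂ) + v * Complex.I) * x)))) v := by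
    intro v
    have h := hasDerivAt_line 1 v
    have h1 := ((h.pow 3).div_const 3).cexp
    have h2 := (h.neg.mul_const (x : ℂ)).cexp
    have h3 := h1.mul h2
    simp only [pow_zero, one_mul, airyWeight]
    refine h3.congr_deriv ?_
    simp only [Pi.pow_apply, Pi.neg_apply]
    push_cast
    ring
  have h2 := integrable_airy_integrand 2 x
  have h0 := integrable_airy_integrand 0 x
  have := integral_eq_zero_of_hasDerivAt_of_integrable hd
    ((h2.sub (h0.const_mul _)).const_mul _) h0
  rw [integral_const_mul, integral_sub h2 (h0.const_mul _), integral_const_mul] at this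
  have h3 := (mul_eq_zero.mp this).resolve_left Complex.I_ne_zero
  exact sub_eq_zero.mp h3

lemma tendsto_airy_side (x : ℝ) (σ : ℝ) (hσ : σ ^ 2 = 1) :
    Tendsto (fun R : ℝ => ∫ y in (0 : ℝ)..1, Complex.exp (Complex.I *
      ((((σ * R : ℝ) : ℂ) + y * Complex.I) ^ 3 / 3 + x * (((σ * R : ℝ) : ℂ) + y * Complex.I))))
      atTop (𝓝 0) := by
  have hn : ∀ R y : ℝ, ‖Complex.exp (Complex.I *
      ((((σ * R : ℝ) : ℂ) + y * Complex.I) ^ 3 / 3 + x * (((σ * R : ℝ) : ℂ) + y * Complex.I)))‖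
      = Real.exp (-(R ^ 2 * y) + (y ^ 3 / 3 - x * y)) := by
    intro R y
    have h : Complex.I *
      ((((σ * R : ℝ) : ℂ) + y * Complex.I) ^ 3 / 3 + x * (((σ * R : ℝ) : ℂ) + y * Complex.I))
      = ((-((σ * R) ^ 2 * y) + (y ^ 3 / 3 - x * y) : ℝ) : ℂ)
        + (((σ * R) ^ 3 / 3 - σ * R * y ^ 2 + x * (σ * R) : ℝ) : ℂ) * Complex.I := by
      push_cast
      linear_combination ((σ * R) ^ 2 * y + x * y + (σ * R) * y ^ 2 * Complex.I
        + y ^ 3 / 3 * (Complex.I ^ 2 - 1) : ℂ) * Complex.I_sq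
    rw [h, Complex.norm_exp]
    congr 1
    simp only [Complex.add_re, Complex.re_ofReal_mul, Complex.I_re, Complex.ofReal_re, mul_zero,
      add_zero, mul_pow, hσ, one_mul]
  have key := intervalIntegral.tendsto_integral_filter_of_dominated_convergence
    (μ := volume) (a := 0) (b := 1) (l := atTop)
    (F := fun (R : ℝ) (y : ℝ) => Complex.exp (Complex.I *
      ((((σ * R : ℝ) : ℂ) + y * Complex.I) ^ 3 / 3 + x * (((σ * R : ℝ) : ℂ) + y * Complex.I))))
    (f := fun _ => 0) (fun _ => Real.exp (1 / 3 + |x|))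
    (Eventually.of_forall fun R => (by fun_prop : Continuous _).aestronglyMeasurable)
    (Eventually.of_forall fun R => Eventually.of_forall fun y hy => ?_)
    (by simp)
    (Eventually.of_forall fun y hy => ?_)
  · simpa using key
  · rw [Set.uIoc_of_le zero_le_one] at hy
    rw [hn]
    refine Real.exp_le_exp.mpr ?_
    have h1 : y ^ 3 ≤ 1 := pow_le_one₀ hy.1.le hy.2
    have h2 : -(x * y) ≤ |x| := by
      calc -(x * y) ≤ |x * y| := neg_le_abs _
        _ = |x| * y := by rw [abs_mul, abs_of_pos hy.1]
        _ ≤ |x| * 1 := by gcongr; exact hy.2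
        _ = |x| := mul_one _
    have h3 : 0 ≤ R ^ 2 * y := mul_nonneg (sq_nonneg _) hy.1.le
    linarith
  · rw [Set.uIoc_of_le zero_le_one] at hy
    rw [tendsto_zero_iff_norm_tendsto_zero]
    simp only [hn]
    refine Real.tendsto_exp_atBot.comp (tendsto_atBot_add_const_right _ _ ?_)
    exact tendsto_neg_atTop_atBot.comp
      ((tendsto_pow_atTop two_ne_zero).atTop_mul_const hy.1)

lemma tendsto_integral_cos_airy (x : ℝ) :
    Tendsto (fun R : ℝ => ((∫ t in (0 : ℝ)..R, Real.cos (t ^ 3 / 3 + x * t) : ℝ) : ℂ)) atTop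
      (𝓝 (airyMoment 0 x / 2)) := by
  set f : ℂ → ℂ := fun z => Complex.exp (Complex.I * (z ^ 3 / 3 + x * z)) with hf
  have hdiff : Differentiable ℂ f := by rw [hf]; fun_prop
  have hcont : Continuous fun v : ℝ => f v := hdiff.continuous.comp Complex.continuous_ofReal
  have hbot : ∀ R : ℝ, ∫ v in (-R)..R, f v
      = 2 * ((∫ t in (0 : ℝ)..R, Real.cos (t ^ 3 / 3 + x * t) : ℝ) : ℂ) := by
    intro R
    rw [← intervalIntegral.integral_add_adjacent_intervals (b := 0)
      (hcont.intervalIntegrable _ _) (hcont.intervalIntegrable _ _)]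
    have h1 : ∫ v in (-R)..0, f v = ∫ v in (0 : ℝ)..R, f ((-v : ℝ) : ℂ) := by
      rw [intervalIntegral.integral_comp_neg (fun v : ℝ => f (v : ℂ)), neg_zero]
    have hcont' : Continuous fun v : ℝ => f ((-v : ℝ) : ℂ) := hcont.comp continuous_neg
    rw [h1, ← intervalIntegral.integral_add
      (hcont'.intervalIntegrable _ _) (hcont.intervalIntegrable _ _),
      ← intervalIntegral.integral_ofReal, ← intervalIntegral.integral_const_mul]
    congr 1
    ext v
    simp only [hf]
    push_cast
    rw [Complex.two_cos]
    rw [add_comm]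
    congr 2 <;> ring
  have hid : ∀ R : ℝ, ((∫ t in (0 : ℝ)..R, Real.cos (t ^ 3 / 3 + x * t) : ℝ) : ℂ)
      = ((∫ v in (-R)..R, (((1 : ℝ) : ℂ) + v * Complex.I) ^ 0 * airyWeight v *
          Complex.exp (-(((1 : ℝ) : ℂ) + v * Complex.I) * x))
        - Complex.I * (∫ y in (0 : ℝ)..1, f (((1 * R : ℝ) : ℂ) + y * Complex.I))
        + Complex.I * (∫ y in (0 : ℝ)..1, f (((-1 * R : ℝ) : ℂ) + y * Complex.I))) / 2 := by
    intro R
    have h := Complex.integral_boundary_rect_eq_zero_of_differentiableOn f ((-R : ℝ) : ℂ)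
      ((R : ℂ) + Complex.I) hdiff.differentiableOn
    simp only [Complex.ofReal_re, Complex.ofReal_im, Complex.add_re, Complex.I_re, add_zero,
      Complex.add_im, Complex.I_im, zero_add, Complex.ofReal_zero, zero_mul, smul_eq_mul,
      Complex.ofReal_one, one_mul] at h
    rw [hbot] at h
    have htop : (∫ v in (-R)..R, f ((v : ℂ) + Complex.I)) =
        ∫ v in (-R)..R, (((1 : ℝ) : ℂ) + v * Complex.I) ^ 0 * airyWeight v *
          Complex.exp (-(((1 : ℝ) : ℂ) + v * Complex.I) * x) := by
      have := intervalIntegral.integral_comp_neg (a := -R) (b := R)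
        (fun v : ℝ => (((1 : ℝ) : ℂ) + v * Complex.I) ^ 0 * airyWeight v *
          Complex.exp (-(((1 : ℝ) : ℂ) + v * Complex.I) * x))
      rw [neg_neg] at this
      rw [← this]
      congr 1
      ext v
      simp only [hf, airyWeight, pow_zero, one_mul]
      rw [← Complex.exp_add]
      congr 1
      push_cast
      linear_combination (-(1 / 3 : ℂ) + v * Complex.I + x + Complex.I ^ 2 / 3
        + v ^ 3 * Complex.I / 3) * Complex.I_sq
    rw [htop] at h
    rw [one_mul, neg_one_mul]
    linear_combination h / 2
  have hside := tendsto_airy_side x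
  have hmain := intervalIntegral_tendsto_integral (integrable_airy_integrand 0 x)
    tendsto_neg_atTop_atBot tendsto_id
  have := ((hmain.sub ((hside 1 (by norm_num)).const_mul Complex.I)).add
    ((hside (-1) (by norm_num)).const_mul Complex.I)).div_const 2
  rw [mul_zero, sub_zero, add_zero] at this
  refine this.congr fun R => ?_
  rw [hid]
  rfl

lemma Ai_eq (x : ℝ) : Ai x = (2 * π)⁻¹ * (airyMoment 0 x).re := by
  have h := (Complex.continuous_re.tendsto _).comp (tendsto_integral_cos_airy x)
  have h2 : Tendsto (fun R : ℝ => ∫ t in (0 : ℝ)..R, Real.cos (t ^ 3 / 3 + x * t)) atTop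
      (𝓝 ((airyMoment 0 x).re / 2)) := by
    simpa [Function.comp_def] using h
  rw [Ai, h2.limUnder_eq, mul_inv]
  ring

/-- The derivative of the Airy function, as a contour integral. -/
noncomputable def AiDeriv (x : ℝ) : ℝ := -((2 * π)⁻¹ * (airyMoment 1 x).re)

lemma hasDerivAt_re_airyMoment (k : ℕ) (x : ℝ) :
    HasDerivAt (fun x => (airyMoment k x).re) (-(airyMoment (k + 1) x).re) x := by
  have h := hasDerivAt_lineMoment (b := 1) continuous_airyWeight (by positivity) one_pos
    norm_airyWeight_le k x
  exact (Complex.reCLM.hasFDerivAt.comp_hasDerivAt x h).congr_deriv (by simp [airyMoment])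

lemma hasDerivAt_Ai (x : ℝ) : HasDerivAt Ai (AiDeriv x) x := by
  rw [funext Ai_eq]
  exact ((hasDerivAt_re_airyMoment 0 x).const_mul _).congr_deriv (by rw [AiDeriv]; ring)

lemma hasDerivAt_AiDeriv (x : ℝ) : HasDerivAt AiDeriv (x * Ai x) x := by
  refine ((hasDerivAt_re_airyMoment 1 x).const_mul ((2 * π)⁻¹)).neg.congr_deriv ?_
  rw [Ai_eq, airyMoment_two, Complex.re_ofReal_mul]
  ring

lemma exists_abs_re_airyMoment_le (k : ℕ) :
    ∃ K > 0, ∀ x, |(2 * π)⁻¹ * (airyMoment k x).re| ≤ K * Real.exp (-x) := by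
  obtain ⟨K, hK, h⟩ := exists_norm_lineMoment_le (b := 1) (by positivity) one_pos
    norm_airyWeight_le k
  refine ⟨(2 * π)⁻¹ * K, by positivity, fun x => ?_⟩
  rw [abs_mul, abs_of_pos (by positivity : 0 < (2 * π)⁻¹), mul_assoc]
  gcongr
  refine (Complex.abs_re_le_norm _).trans ?_
  simpa [airyMoment] using h x

lemma exists_abs_Ai_le : ∃ K > 0, ∀ x, |Ai x| ≤ K * Real.exp (-x) := by
  simpa only [← Ai_eq] using exists_abs_re_airyMoment_le 0

lemma exists_abs_AiDeriv_le : ∃ K > 0, ∀ x, |AiDeriv x| ≤ K * Real.exp (-x) := by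
  simpa only [AiDeriv, abs_neg] using exists_abs_re_airyMoment_le 1

/-! ### Oscillator wave functions -/

/-- The `n`-th derivative of `e^{-x²}`. -/
noncomputable def gaussDeriv (n : ℕ) (x : ℝ) : ℝ :=
  iteratedDeriv n (fun t : ℝ => Real.exp (-t ^ 2)) x

lemma hasDerivAt_gaussDeriv (n : ℕ) (x : ℝ) :
    HasDerivAt (gaussDeriv n) (gaussDeriv (n + 1) x) x := by
  have hs : ContDiff ℝ (n + 1) (fun t : ℝ => Real.exp (-t ^ 2)) := by fun_prop
  have h := (hs.differentiable_iteratedDeriv n (by exact_mod_cast n.lt_succ_self) x).hasDerivAt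
  rw [← iteratedDeriv_succ] at h
  exact h

lemma gaussDeriv_zero (x : ℝ) : gaussDeriv 0 x = Real.exp (-x ^ 2) := by simp [gaussDeriv]

lemma gaussDeriv_one (x : ℝ) : gaussDeriv 1 x = -2 * x * gaussDeriv 0 x := by
  refine (hasDerivAt_gaussDeriv 0 x).unique ?_
  rw [funext gaussDeriv_zero]
  exact ((hasDerivAt_pow 2 x).neg.exp).congr_deriv (by simp; ring)

lemma gaussDeriv_add_two (n : ℕ) (x : ℝ) :
    gaussDeriv (n + 2) x = -2 * x * gaussDeriv (n + 1) x - 2 * (n + 1) * gaussDeriv n x := by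
  induction n generalizing x with
  | zero =>
    refine (hasDerivAt_gaussDeriv 1 x).unique ?_
    rw [funext gaussDeriv_one]
    exact ((((hasDerivAt_id x).const_mul (-2)).mul (hasDerivAt_gaussDeriv 0 x))).congr_deriv
      (by simp [gaussDeriv_one]; ring)
  | succ n ih =>
    refine (hasDerivAt_gaussDeriv (n + 2) x).unique ?_
    rw [funext ih]
    exact ((((hasDerivAt_id x).const_mul (-2)).mul (hasDerivAt_gaussDeriv (n + 1) x)).sub
      ((hasDerivAt_gaussDeriv n x).const_mul (2 * ((n : ℝ) + 1)))).congr_deriv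
      (by simp [ih]; ring)

lemma exists_gaussDeriv_eq (n : ℕ) :
    ∃ P : Polynomial ℝ, ∀ x, gaussDeriv n x = P.eval x * Real.exp (-x ^ 2) := by
  induction n with
  | zero => exact ⟨1, fun x => by simp [gaussDeriv_zero]⟩
  | succ n ih =>
    obtain ⟨P, hP⟩ := ih
    refine ⟨P.derivative - Polynomial.C 2 * Polynomial.X * P, fun x => ?_⟩
    refine (hasDerivAt_gaussDeriv n x).unique ?_
    rw [funext hP]
    exact ((P.hasDerivAt x).mul (hasDerivAt_pow 2 x).neg.exp).congr_deriv (by simp; ring)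

lemma tendsto_polynomial_mul_exp_neg_sq (P : Polynomial ℝ) :
    Tendsto (fun x => P.eval x * Real.exp (-x ^ 2 / 2)) atTop (𝓝 0) := by
  have h := P.tendsto_div_exp_atTop
  rw [tendsto_zero_iff_norm_tendsto_zero] at h ⊢
  refine squeeze_zero' (Eventually.of_forall fun x => norm_nonneg _) ?_ h
  filter_upwards [eventually_ge_atTop 2] with x hx
  rw [div_eq_mul_inv (P.eval x), ← Real.exp_neg, norm_mul, norm_mul, Real.norm_of_nonneg (Real.exp_pos _).le,
    Real.norm_of_nonneg (Real.exp_pos _).le]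
  gcongr
  nlinarith

/-- The constant in `φ_n(x) = c_n e^{x²/2} (e^{-x²})^{(n)}`. -/
noncomputable def oscConst (n : ℕ) : ℝ := hNorm n ^ (-(1 : ℝ) / 2) * (-1) ^ n

lemma osc_eq (n : ℕ) (x : ℝ) :
    osc n x = oscConst n * (Real.exp (x ^ 2 / 2) * gaussDeriv n x) := by
  have h : Real.exp (x ^ 2 / 2) = Real.exp (-x ^ 2 / 2) * Real.exp (x ^ 2) := by
    rw [← Real.exp_add]; ring_nf
  rw [osc, physHermite, oscConst, h, gaussDeriv]
  ring

/-- The derivative of the oscillator wave function. -/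
noncomputable def oscDeriv (n : ℕ) (x : ℝ) : ℝ :=
  oscConst n * (Real.exp (x ^ 2 / 2) * (x * gaussDeriv n x + gaussDeriv (n + 1) x))

lemma hasDerivAt_exp_half_sq (x : ℝ) :
    HasDerivAt (fun x : ℝ => Real.exp (x ^ 2 / 2)) (Real.exp (x ^ 2 / 2) * x) x :=
  (((hasDerivAt_pow 2 x).div_const 2).exp).congr_deriv (by simp)

lemma hasDerivAt_osc (n : ℕ) (x : ℝ) : HasDerivAt (osc n) (oscDeriv n x) x := by
  rw [funext (osc_eq n)]
  exact (((hasDerivAt_exp_half_sq x).mul (hasDerivAt_gaussDeriv n x)).const_mul _).congr_deriv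
    (by rw [oscDeriv]; ring)

/-- The oscillator equation `φ_n'' = (x² - (2n+1)) φ_n`. -/
lemma hasDerivAt_oscDeriv (n : ℕ) (x : ℝ) :
    HasDerivAt (oscDeriv n) ((x ^ 2 - (2 * n + 1)) * osc n x) x := by
  refine (((hasDerivAt_exp_half_sq x).mul (((hasDerivAt_id x).mul
    (hasDerivAt_gaussDeriv n x)).add (hasDerivAt_gaussDeriv (n + 1) x))).const_mul
    (oscConst n)).congr_deriv ?_
  simp only [osc_eq, gaussDeriv_add_two, Pi.mul_apply, Pi.add_apply, id_eq]
  ring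

lemma tendsto_osc (n : ℕ) : Tendsto (osc n) atTop (𝓝 0) := by
  obtain ⟨P, hP⟩ := exists_gaussDeriv_eq n
  have h := (tendsto_polynomial_mul_exp_neg_sq P).const_mul (oscConst n)
  rw [mul_zero] at h
  refine h.congr fun x => ?_
  rw [osc_eq, hP, show -x ^ 2 / 2 = x ^ 2 / 2 + -x ^ 2 by ring, Real.exp_add]
  ring

lemma tendsto_oscDeriv (n : ℕ) : Tendsto (oscDeriv n) atTop (𝓝 0) := by
  obtain ⟨P, hP⟩ := exists_gaussDeriv_eq n
  obtain ⟨Q, hQ⟩ := exists_gaussDeriv_eq (n + 1)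
  have h := (tendsto_polynomial_mul_exp_neg_sq (Polynomial.X * P + Q)).const_mul (oscConst n)
  rw [mul_zero] at h
  refine h.congr fun x => ?_
  rw [oscDeriv, hP, hQ, show -x ^ 2 / 2 = x ^ 2 / 2 + -x ^ 2 by ring, Real.exp_add]
  simp only [Polynomial.eval_add, Polynomial.eval_mul, Polynomial.eval_X]
  ring

/-! ### The contour integral for Hermite functions -/

/-- The weight `e^{w²}` on the line `w = b + i v`. -/
noncomputable def gaussWeight (b v : ℝ) : ℂ := Complex.exp (((b : ℂ) + v * Complex.I) ^ 2)

lemma continuous_gaussWeight (b : ℝ) : Continuous (gaussWeight b) := by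
  unfold gaussWeight; fun_prop

lemma norm_gaussWeight_le (b v : ℝ) :
    ‖gaussWeight b v‖ ≤ Real.exp (b ^ 2) * Real.exp (-1 * v ^ 2) := by
  rw [gaussWeight, Complex.norm_exp, ← Real.exp_add]
  simp [sq]

lemma gaussDeriv_eq_lineMoment (b : ℝ) (n : ℕ) (x : ℝ) :
    ((√π * gaussDeriv n x : ℝ) : ℂ) = (-2) ^ n * lineMoment b (gaussWeight b) n (2 * x) := by
  induction n generalizing x with
  | zero =>
    have h := integral_cexp_quadratic (b := -1) (by simp)
      (2 * (b - x) * Complex.I) ((b : ℂ) ^ 2 - 2 * b * x)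
    have h2 : lineMoment b (gaussWeight b) 0 (2 * x) = ∫ v : ℝ,
        Complex.exp (-1 * (v : ℂ) ^ 2 + 2 * (b - x) * Complex.I * v
          + ((b : ℂ) ^ 2 - 2 * b * x)) := by
      rw [lineMoment]
      congr 1
      ext v
      rw [pow_zero, one_mul, gaussWeight, ← Complex.exp_add]
      congr 1
      push_cast
      linear_combination (v : ℂ) ^ 2 * Complex.I_sq
    rw [pow_zero, one_mul, h2, h, gaussDeriv_zero, neg_neg, div_one]
    push_cast
    congr 1
    · rw [show ((1 : ℂ) / 2) = (((1 : ℝ) / 2 : ℝ) : ℂ) by norm_num,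
        ← Complex.ofReal_cpow Real.pi_pos.le, ← Real.sqrt_eq_rpow]
    · congr 1
      linear_combination ((b : ℂ) - x) ^ 2 * (-1) * Complex.I_sq
  | succ n ih =>
    have h1 : HasDerivAt (fun x : ℝ => ((√π * gaussDeriv n x : ℝ) : ℂ))
        ((√π * gaussDeriv (n + 1) x : ℝ) : ℂ) x :=
      ((hasDerivAt_gaussDeriv n x).const_mul _).ofReal_comp
    refine h1.unique ?_
    rw [funext ih]
    have h2 := (hasDerivAt_lineMoment (b := b) (continuous_gaussWeight b) (by positivity)
      one_pos (norm_gaussWeight_le b) n (2 * x)).scomp x ((hasDerivAt_id x).const_mul 2)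
    refine (h2.const_mul ((-2) ^ n)).congr_deriv ?_
    simp
    ring

lemma osc_eq_lineMoment (b : ℝ) (n : ℕ) (x : ℝ) :
    osc n x = hNorm n ^ (-(1 : ℝ) / 2) * 2 ^ n / √π * Real.exp (x ^ 2 / 2) *
      (lineMoment b (gaussWeight b) n (2 * x)).re := by
  have h := congrArg Complex.re (gaussDeriv_eq_lineMoment b n x)
  rw [Complex.ofReal_re, show ((-2 : ℂ) ^ n) = (((-2) ^ n : ℝ) : ℂ) by push_cast; rfl,
    Complex.re_ofReal_mul] at h
  have hp : √π ≠ 0 := by positivity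
  have h2 : gaussDeriv n x = (-1) ^ n * 2 ^ n / √π *
      (lineMoment b (gaussWeight b) n (2 * x)).re := by
    rw [div_mul_eq_mul_div, eq_div_iff hp, mul_comm, h, ← mul_pow]
    norm_num
  rw [osc_eq, h2, oscConst]
  have h3 : ((-1 : ℝ) ^ n) * (-1) ^ n = 1 := by rw [← mul_pow]; norm_num
  linear_combination hNorm n ^ (-(1 : ℝ) / 2) * Real.exp (x ^ 2 / 2) * 2 ^ n / √π *
      (lineMoment b (gaussWeight b) n (2 * x)).re * h3

/-! ### Value at the turning point -/

/-- The rescaled integrand of the contour integral at the turning point `√(2n+1)`. -/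
noncomputable def edgeKernel (n : ℕ) (r v : ℝ) : ℂ :=
  (1 + r * (((1 : ℝ) : ℂ) + v * Complex.I)) ^ n *
    Complex.exp (-((n : ℂ) + 1 / 2) * (r * (((1 : ℝ) : ℂ) + v * Complex.I)
      - (r * (((1 : ℝ) : ℂ) + v * Complex.I)) ^ 2 / 2))

lemma continuous_edgeKernel (n : ℕ) (r : ℝ) : Continuous (edgeKernel n r) := by
  unfold edgeKernel; fun_prop

lemma lineMoment_turning_point (n : ℕ) {r u : ℝ} (hr : 0 < r) (hu : 0 < u)
    (hun : u ^ 2 = 2 * n + 1) :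
    lineMoment (u / 2 * (1 + r)) (gaussWeight (u / 2 * (1 + r))) n (2 * u) =
      (((u / 2) ^ (n + 1) * r * Real.exp (-(3 / 2) * (n + 1 / 2)) : ℝ) : ℂ) *
        ∫ v, edgeKernel n r v := by
  have h := Measure.integral_comp_mul_left
    (fun v : ℝ => (((u / 2 * (1 + r) : ℝ) : ℂ) + v * Complex.I) ^ n *
      gaussWeight (u / 2 * (1 + r)) v *
      Complex.exp (-(((u / 2 * (1 + r) : ℝ) : ℂ) + v * Complex.I) * ((2 * u : ℝ) : ℂ)))
    (u / 2 * r)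
  have hpos : 0 < u / 2 * r := by positivity
  have hun' : (u : ℂ) ^ 2 = 2 * n + 1 := by exact_mod_cast hun
  have h2 : ∀ v : ℝ, (((u / 2 * (1 + r) : ℝ) : ℂ) + ((u / 2 * r * v : ℝ) : ℂ) * Complex.I) ^ n *
      gaussWeight (u / 2 * (1 + r)) (u / 2 * r * v) *
      Complex.exp (-(((u / 2 * (1 + r) : ℝ) : ℂ) + ((u / 2 * r * v : ℝ) : ℂ) * Complex.I) *
        ((2 * u : ℝ) : ℂ)) =
      (((u / 2) ^ n * Real.exp (-(3 / 2) * (n + 1 / 2)) : ℝ) : ℂ) * edgeKernel n r v := by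
    intro v
    have e1 : (((u / 2 * (1 + r) : ℝ) : ℂ) + ((u / 2 * r * v : ℝ) : ℂ) * Complex.I)
        = (u / 2 : ℂ) * (1 + r * (((1 : ℝ) : ℂ) + v * Complex.I)) := by
      push_cast; ring
    rw [gaussWeight, edgeKernel, e1, mul_pow]
    push_cast
    rw [mul_assoc, ← Complex.exp_add]
    rw [mul_assoc, mul_assoc, mul_left_comm (Complex.exp _), ← Complex.exp_add]
    congr 3
    linear_combination ((1 + r * (1 + v * Complex.I)) ^ 2 / 4
      - (1 + r * (1 + v * Complex.I))) * hun'
  simp only [h2] at h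
  rw [integral_const_mul, abs_of_pos (inv_pos.mpr hpos)] at h
  rw [eq_inv_smul_iff₀ hpos.ne'] at h
  rw [lineMoment, ← h, Complex.real_smul]
  push_cast
  ring

lemma norm_edgeKernel_le {n : ℕ} {r : ℝ} (hr : 0 < r) (hr2 : r ≤ 1 / 2)
    (hnr : ((n : ℝ) + 1 / 2) * r ^ 3 = 1) (v : ℝ) :
    ‖edgeKernel n r v‖ ≤ Real.exp (1 / 2) * Real.exp (-(v ^ 2 / 2)) := by
  set m : ℝ := (n : ℝ) + 1 / 2 with hm
  set X : ℝ := r - r ^ 2 / 2 + r ^ 3 / 2 + r ^ 2 * v ^ 2 / (2 * (1 + r) ^ 2) with hX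
  have hy : 0 ≤ r - r ^ 2 / 2 + r ^ 3 / 2 := by nlinarith [pow_pos hr 3]
  have hn1 : ‖(1 : ℂ) + r * (((1 : ℝ) : ℂ) + v * Complex.I)‖ ≤ Real.exp X := by
    have h1 : ‖(1 : ℂ) + r * (((1 : ℝ) : ℂ) + v * Complex.I)‖ ^ 2
        = (1 + r) ^ 2 * (1 + r ^ 2 * v ^ 2 / (1 + r) ^ 2) := by
      rw [show (1 : ℂ) + r * (((1 : ℝ) : ℂ) + v * Complex.I)
        = ((1 + r : ℝ) : ℂ) + ((r * v : ℝ) : ℂ) * Complex.I by push_cast; ring, norm_line_sq]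
      field_simp
    have h2 : 1 + r ≤ Real.exp (r - r ^ 2 / 2 + r ^ 3 / 2) := by
      refine le_trans ?_ (Real.quadratic_le_exp_of_nonneg hy)
      nlinarith [pow_pos hr 3, pow_pos hr 4, pow_pos hr 5, sq_nonneg (r ^ 3),
        mul_pos hr (pow_pos hr 3)]
    have h3 : 1 + r ^ 2 * v ^ 2 / (1 + r) ^ 2 ≤ Real.exp (r ^ 2 * v ^ 2 / (1 + r) ^ 2) := by
      rw [add_comm]; exact Real.add_one_le_exp _
    refine (sq_le_sq₀ (norm_nonneg _) (Real.exp_pos _).le).mp ?_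
    rw [h1]
    have h4 : Real.exp X ^ 2 = Real.exp (r - r ^ 2 / 2 + r ^ 3 / 2) ^ 2 *
        Real.exp (r ^ 2 * v ^ 2 / (1 + r) ^ 2) := by
      rw [← Real.exp_nat_mul, ← Real.exp_nat_mul, ← Real.exp_add, hX]
      congr 1
      push_cast
      field_simp
    rw [h4]
    gcongr
  have hn2 : ‖(1 : ℂ) + r * (((1 : ℝ) : ℂ) + v * Complex.I)‖ ^ n ≤ Real.exp (m * X) := by
    calc _ ≤ Real.exp X ^ n := by gcongr
      _ = Real.exp (n * X) := by rw [Real.exp_nat_mul]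
      _ ≤ _ := by gcongr; rw [hm]; linarith
  have hn3 : ‖Complex.exp (-((n : ℂ) + 1 / 2) * (r * (((1 : ℝ) : ℂ) + v * Complex.I)
      - (r * (((1 : ℝ) : ℂ) + v * Complex.I)) ^ 2 / 2))‖
      = Real.exp (-m * (r - (r ^ 2 - r ^ 2 * v ^ 2) / 2)) := by
    have : -((n : ℂ) + 1 / 2) * (r * (((1 : ℝ) : ℂ) + v * Complex.I)
      - (r * (((1 : ℝ) : ℂ) + v * Complex.I)) ^ 2 / 2)
      = ((-m * (r - (r ^ 2 - r ^ 2 * v ^ 2) / 2) : ℝ) : ℂ)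
        + ((-m * (r * v - r ^ 2 * v) : ℝ) : ℂ) * Complex.I := by
      rw [hm]
      push_cast
      linear_combination (((n : ℂ) + 1 / 2) * r ^ 2 * v ^ 2 / 2) * Complex.I_sq
    rw [this, Complex.norm_exp]
    congr 1
    simp only [Complex.add_re, Complex.re_ofReal_mul, Complex.I_re, Complex.ofReal_re, mul_zero,
      add_zero]
  rw [edgeKernel, norm_mul, norm_pow, hn3]
  refine (mul_le_mul_of_nonneg_right hn2 (Real.exp_pos _).le).trans ?_
  rw [← Real.exp_add, ← Real.exp_add]
  refine Real.exp_le_exp.mpr ?_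
  have h5 : 1 / (1 + r) ^ 2 ≤ 1 - r := by
    rw [div_le_iff₀ (by positivity)]
    nlinarith [mul_pos hr hr, pow_pos hr 3]
  have h6 : r ^ 2 * v ^ 2 / (2 * (1 + r) ^ 2) ≤ r ^ 2 * v ^ 2 / 2 * (1 - r) := by
    calc _ = r ^ 2 * v ^ 2 / 2 * (1 / (1 + r) ^ 2) := by field_simp
      _ ≤ _ := by gcongr
  calc m * X + -m * (r - (r ^ 2 - r ^ 2 * v ^ 2) / 2)
      = m * r ^ 3 / 2 + (m * (r ^ 2 * v ^ 2 / (2 * (1 + r) ^ 2)) - m * (r ^ 2 * v ^ 2 / 2)) := by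
        rw [hX]; ring
    _ ≤ m * r ^ 3 / 2 + (m * (r ^ 2 * v ^ 2 / 2 * (1 - r)) - m * (r ^ 2 * v ^ 2 / 2)) := by
        gcongr
    _ = m * r ^ 3 / 2 - m * r ^ 3 * v ^ 2 / 2 := by ring
    _ = 1 / 2 + -(v ^ 2 / 2) := by rw [hnr]; ring

/-- First-order correction to `e^{t³/3}` in the integrand at the turning point. -/
noncomputable def edgeCorrection (v : ℝ) : ℂ :=
  (((1 : ℝ) : ℂ) + v * Complex.I) ^ 4 / 4 + (((1 : ℝ) : ℂ) + v * Complex.I) / 2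

lemma one_le_norm_line (v : ℝ) : 1 ≤ ‖((1 : ℝ) : ℂ) + v * Complex.I‖ := by
  have := norm_line_sq 1 v
  nlinarith [sq_nonneg v, norm_nonneg (((1 : ℝ) : ℂ) + v * Complex.I)]

lemma norm_edgeCorrection_le (v : ℝ) :
    ‖edgeCorrection v‖ ≤ 3 / 4 * ‖((1 : ℝ) : ℂ) + v * Complex.I‖ ^ 4 := by
  have h1 := one_le_norm_line v
  have h2 : ‖((1 : ℝ) : ℂ) + v * Complex.I‖ ≤ ‖((1 : ℝ) : ℂ) + v * Complex.I‖ ^ 4 :=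
    le_self_pow₀ h1 (by norm_num)
  refine (norm_add_le _ _).trans ?_
  rw [norm_div, norm_div, norm_pow]
  norm_num at h2 ⊢
  linarith

lemma norm_exp_sub_one_sub_le (A q : ℂ) {B : ℝ} (hA : ‖A‖ ≤ B) :
    ‖Complex.exp A - (1 - q)‖ ≤ B ^ 2 * Real.exp B + ‖A + q‖ := by
  have h := Complex.norm_exp_sub_sum_le_norm_mul_exp A 2
  simp only [Finset.sum_range_succ, Finset.sum_range_zero, pow_zero, pow_one, Nat.factorial_zero,
    Nat.factorial_one, Nat.cast_one, div_one, zero_add] at h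
  calc ‖Complex.exp A - (1 - q)‖ = ‖(Complex.exp A - (1 + A)) + (A + q)‖ := by
        congr 1; ring
    _ ≤ ‖Complex.exp A - (1 + A)‖ + ‖A + q‖ := norm_add_le _ _
    _ ≤ _ := by
      gcongr
      exact h.trans (by gcongr)

lemma edgeKernel_eq_of_small {n : ℕ} {r : ℝ} (hnr : ((n : ℝ) + 1 / 2) * r ^ 3 = 1) (v : ℝ)
    (h0 : (1 : ℂ) + r * (((1 : ℝ) : ℂ) + v * Complex.I) ≠ 0) :
    edgeKernel n r v = airyWeight v * Complex.exp (((n : ℂ) + 1 / 2) *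
      (Complex.log (1 + r * (((1 : ℝ) : ℂ) + v * Complex.I))
        - r * (((1 : ℝ) : ℂ) + v * Complex.I) + (r * (((1 : ℝ) : ℂ) + v * Complex.I)) ^ 2 / 2
        - (r * (((1 : ℝ) : ℂ) + v * Complex.I)) ^ 3 / 3)
      - Complex.log (1 + r * (((1 : ℝ) : ℂ) + v * Complex.I)) / 2) := by
  have hnr' : ((n : ℂ) + 1 / 2) * (r : ℂ) ^ 3 = 1 := by
    have := congrArg (fun x : ℝ => (x : ℂ)) hnr
    push_cast at this
    exact this
  rw [edgeKernel, airyWeight]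
  conv_lhs => rw [← Complex.exp_log h0]
  rw [← Complex.exp_nat_mul, ← Complex.exp_add, ← Complex.exp_add]
  congr 1
  linear_combination ((((1 : ℝ) : ℂ) + v * Complex.I) ^ 3 / 3) * hnr'

lemma norm_edgeKernel_sub_le {n : ℕ} {r : ℝ} (hr : 0 < r) (hr4 : r ≤ 1 / 4)
    (hnr : ((n : ℝ) + 1 / 2) * r ^ 3 = 1) (v : ℝ) :
    ‖edgeKernel n r v - airyWeight v * (1 - r * edgeCorrection v)‖ ≤
      10 * Real.exp 3 * r ^ 2 * (‖((1 : ℝ) : ℂ) + v * Complex.I‖ ^ 8 *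
        Real.exp (-(v ^ 2 / 2))) := by
  have hT1 := one_le_norm_line v
  have hq := norm_edgeCorrection_le v
  set t : ℂ := ((1 : ℝ) : ℂ) + v * Complex.I with ht
  set T := ‖t‖ with hT
  have hT0 : 0 ≤ T := by linarith
  have hw : ‖airyWeight v‖ ≤ Real.exp (1 / 3) * Real.exp (-(v ^ 2 / 2)) := by
    rw [norm_airyWeight]
    gcongr
    nlinarith [sq_nonneg v]
  have he1 : Real.exp (1 / 3) ≤ Real.exp 1 := Real.exp_le_exp.mpr (by norm_num)
  have he2 : Real.exp (1 / 2) ≤ Real.exp 3 := Real.exp_le_exp.mpr (by norm_num)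
  have he3 : Real.exp 1 * Real.exp 2 = Real.exp 3 := by rw [← Real.exp_add]; norm_num
  have he4 : (1 : ℝ) ≤ Real.exp 2 := Real.one_le_exp (by norm_num)
  set g := Real.exp (-(v ^ 2 / 2)) with hg
  rcases le_or_gt (r * T ^ 4) 1 with hsmall | hlarge
  · have hp : r * T ≤ 1 / 2 := by
      by_contra! hcon
      have h1 : (1 / 2 : ℝ) ^ 4 < (r * T) ^ 4 := by gcongr
      have h2 : (r * T) ^ 4 = r ^ 3 * (r * T ^ 4) := by ring
      have h3 : r ^ 3 ≤ (1 / 4) ^ 3 := by gcongr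
      have h4 : r ^ 3 * (r * T ^ 4) ≤ (1 / 4) ^ 3 * 1 := by gcongr
      norm_num at h1 h4
      linarith
    have hpn : ‖(r : ℂ) * t‖ = r * T := by
      rw [norm_mul, Complex.norm_real, Real.norm_of_nonneg hr.le]
    have hplt : ‖(r : ℂ) * t‖ < 1 := by rw [hpn]; linarith
    have h0 : (1 : ℂ) + r * t ≠ 0 := by
      intro h
      have : (r : ℂ) * t = -1 := by linear_combination h
      rw [this] at hplt
      simp at hplt
    have hinv : (1 - r * T)⁻¹ ≤ 2 := by
      rw [inv_le_comm₀ (by linarith) (by norm_num)]; linarith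
    have hL4 := Complex.norm_log_sub_logTaylor_le 4 hplt
    have hL1 := Complex.norm_log_sub_logTaylor_le 1 hplt
    rw [hpn] at hL4 hL1
    have e4 : Complex.logTaylor (4 + 1) ((r : ℂ) * t)
        = r * t - (r * t) ^ 2 / 2 + (r * t) ^ 3 / 3 - (r * t) ^ 4 / 4 := by
      simp only [Complex.logTaylor_succ, Complex.logTaylor_zero, Pi.add_apply]
      push_cast
      ring
    have e1 : Complex.logTaylor (1 + 1) ((r : ℂ) * t) = r * t := by
      simp only [Complex.logTaylor_succ, Complex.logTaylor_zero, Pi.add_apply]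
      push_cast
      ring
    rw [e4] at hL4
    rw [e1] at hL1
    have hL4' : (r * T) ^ (4 + 1) * (1 - r * T)⁻¹ / ((4 : ℕ) + 1 : ℝ) ≤ (r * T) ^ 5 * (2 / 5) := by
      calc _ ≤ (r * T) ^ (4 + 1) * 2 / ((4 : ℕ) + 1 : ℝ) := by gcongr
        _ = _ := by norm_num; ring
    have hL1' : (r * T) ^ (1 + 1) * (1 - r * T)⁻¹ / ((1 : ℕ) + 1 : ℝ) ≤ (r * T) ^ 2 := by
      calc _ ≤ (r * T) ^ (1 + 1) * 2 / ((1 : ℕ) + 1 : ℝ) := by gcongr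
        _ = _ := by norm_num
    have hL4 := hL4.trans hL4'
    have hL1 := hL1.trans hL1'
    set L := Complex.log (1 + r * t) with hL
    set A : ℂ := ((n : ℂ) + 1 / 2) * (L - r * t + (r * t) ^ 2 / 2 - (r * t) ^ 3 / 3) - L / 2 with hA
    have hm0 : (0 : ℝ) < (n : ℝ) + 1 / 2 := by positivity
    have hnr' : ((n : ℂ) + 1 / 2) * (r : ℂ) ^ 3 = 1 := by
      have := congrArg (fun x : ℝ => (x : ℂ)) hnr
      push_cast at this
      exact this
    have hAq : ‖A + r * edgeCorrection v‖ ≤ r ^ 2 * T ^ 5 := by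
      have h1 : A + r * edgeCorrection v =
          (((n : ℝ) + 1 / 2 : ℝ) : ℂ) * (L - (r * t - (r * t) ^ 2 / 2 + (r * t) ^ 3 / 3
            - (r * t) ^ 4 / 4)) - (L - r * t) / 2 := by
        rw [hA, edgeCorrection, ← ht]
        push_cast
        linear_combination (-(r * t ^ 4) / 4 : ℂ) * hnr'
      have h2 : ‖L - (r * t - (r * t) ^ 2 / 2 + (r * t) ^ 3 / 3 - (r * t) ^ 4 / 4)‖
          ≤ (r * T) ^ 5 * (2 / 5) := hL4
      have h3 : ‖L - r * t‖ ≤ (r * T) ^ 2 := hL1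
      rw [h1]
      refine (norm_sub_le _ _).trans ?_
      rw [norm_mul, norm_div, Complex.norm_real, Real.norm_of_nonneg hm0.le]
      have h4 : ((n : ℝ) + 1 / 2) * ((r * T) ^ 5 * (2 / 5)) = 2 / 5 * (r ^ 2 * T ^ 5) := by
        linear_combination (2 / 5 * (r ^ 2 * T ^ 5)) * hnr
      have h5 : r ^ 2 * T ^ 2 ≤ r ^ 2 * T ^ 5 :=
        mul_le_mul_of_nonneg_left (pow_le_pow_right₀ hT1 (by norm_num)) (by positivity)
      have h6 : ((n : ℝ) + 1 / 2) * ‖L - (r * t - (r * t) ^ 2 / 2 + (r * t) ^ 3 / 3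
          - (r * t) ^ 4 / 4)‖ ≤ 2 / 5 * (r ^ 2 * T ^ 5) := by
        rw [← h4]; gcongr
      have h7 : ‖(2 : ℂ)‖ = 2 := by norm_num
      have h8 : 0 ≤ r ^ 2 * T ^ 5 := by positivity
      rw [h7]
      rw [mul_pow] at h3
      linarith
    have hqn : ‖(r : ℂ) * edgeCorrection v‖ ≤ 3 / 4 * (r * T ^ 4) := by
      rw [norm_mul, Complex.norm_real, Real.norm_of_nonneg hr.le]
      calc _ ≤ r * (3 / 4 * T ^ 4) := by gcongr
        _ = _ := by ring
    have hAn : ‖A‖ ≤ 5 / 4 * (r * T ^ 4) := by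
      have h1 : ‖A‖ ≤ ‖A + r * edgeCorrection v‖ + ‖(r : ℂ) * edgeCorrection v‖ := by
        simpa using norm_sub_le (A + r * edgeCorrection v) (r * edgeCorrection v)
      have h2 : r ^ 2 * T ^ 5 = r * T ^ 4 * (r * T) := by ring
      have h3 : r * T ^ 4 * (r * T) ≤ r * T ^ 4 * (1 / 2) := by gcongr
      linarith
    have hmain := norm_exp_sub_one_sub_le A (r * edgeCorrection v) hAn
    have hE : Real.exp (5 / 4 * (r * T ^ 4)) ≤ Real.exp 2 :=
      Real.exp_le_exp.mpr (by linarith)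
    have h58 : T ^ 5 ≤ T ^ 8 := pow_le_pow_right₀ hT1 (by norm_num)
    have hmain2 : ‖Complex.exp A - (1 - r * edgeCorrection v)‖ ≤
        10 * Real.exp 2 * (r ^ 2 * T ^ 8) := by
      calc _ ≤ (5 / 4 * (r * T ^ 4)) ^ 2 * Real.exp 2 + r ^ 2 * T ^ 8 := by
            refine hmain.trans ?_
            gcongr
            exact hAq.trans (by gcongr)
        _ ≤ (5 / 4 * (r * T ^ 4)) ^ 2 * Real.exp 2 + Real.exp 2 * (r ^ 2 * T ^ 8) := by
            gcongr 1
            exact le_mul_of_one_le_left (by positivity) he4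
        _ = (41 / 16) * (Real.exp 2 * (r ^ 2 * T ^ 8)) := by ring
        _ ≤ 10 * (Real.exp 2 * (r ^ 2 * T ^ 8)) := by gcongr; norm_num
        _ = _ := by ring
    rw [edgeKernel_eq_of_small hnr v h0, ← mul_sub, norm_mul]
    calc _ ≤ (Real.exp 1 * g) * (10 * Real.exp 2 * (r ^ 2 * T ^ 8)) := by
          gcongr
          exact hw.trans (by gcongr)
      _ = _ := by rw [← he3]; ring
  · have h1 : 1 ≤ r ^ 2 * T ^ 8 := by
      have : r ^ 2 * T ^ 8 = (r * T ^ 4) ^ 2 := by ring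
      rw [this]
      exact one_le_pow₀ hlarge.le
    have h2 : r * T ^ 4 ≤ r ^ 2 * T ^ 8 := by
      have : r ^ 2 * T ^ 8 = (r * T ^ 4) * (r * T ^ 4) := by ring
      rw [this]
      exact le_mul_of_one_le_left (by positivity) hlarge.le
    have h3 := norm_edgeKernel_le hr (by linarith) hnr v
    have h4 : ‖1 - (r : ℂ) * edgeCorrection v‖ ≤ 2 * (r ^ 2 * T ^ 8) := by
      refine (norm_sub_le _ _).trans ?_
      rw [norm_one, norm_mul, Complex.norm_real, Real.norm_of_nonneg hr.le]
      have : r * ‖edgeCorrection v‖ ≤ r * (3 / 4 * T ^ 4) := by gcongr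
      nlinarith [mul_nonneg hr.le (pow_nonneg hT0 4)]
    refine (norm_sub_le _ _).trans ?_
    rw [norm_mul]
    calc _ ≤ Real.exp 3 * g * (r ^ 2 * T ^ 8) + (Real.exp 3 * g) * (2 * (r ^ 2 * T ^ 8)) := by
          gcongr
          · refine h3.trans ?_
            rw [← hg]
            refine le_trans (by gcongr) (le_mul_of_one_le_right (by positivity) h1)
          · exact hw.trans (by gcongr; linarith)
      _ = 3 * (Real.exp 3 * g * (r ^ 2 * T ^ 8)) := by ring
      _ ≤ 10 * (Real.exp 3 * g * (r ^ 2 * T ^ 8)) := by gcongr; norm_num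
      _ = _ := by ring

lemma integral_airyWeight_mul_edgeCorrection :
    Integrable (fun v => airyWeight v * edgeCorrection v) ∧
      ∫ v, airyWeight v * edgeCorrection v = 0 := by
  have h2 := integrable_airy_integrand 2 0
  have h1 := integrable_airy_integrand 1 0
  have h4 := integrable_airy_integrand 4 0
  simp only [Complex.ofReal_zero, mul_zero, Complex.exp_zero, mul_one] at h1 h2 h4
  have h_int : Integrable (fun v => airyWeight v * edgeCorrection v) := by
    refine ((h4.const_mul (1 / 4)).add (h1.const_mul (1 / 2))).congr
      (Eventually.of_forall fun v => ?_)
    simp only [Pi.add_apply, edgeCorrection]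
    ring
  refine ⟨h_int, ?_⟩
  have hd : ∀ v : ℝ, HasDerivAt
      (fun v : ℝ => (((1 : ℝ) : ℂ) + v * Complex.I) ^ 2 * airyWeight v)
      (4 * Complex.I * (airyWeight v * edgeCorrection v)) v := by
    intro v
    have h := hasDerivAt_line 1 v
    refine ((h.pow 2).mul ((h.pow 3).div_const 3).cexp).congr_deriv ?_
    simp only [edgeCorrection, airyWeight, Pi.pow_apply]
    push_cast
    ring
  have := integral_eq_zero_of_hasDerivAt_of_integrable hd (h_int.const_mul _) h2
  rw [integral_const_mul] at this
  exact (mul_eq_zero.mp this).resolve_left (by simp)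

/-- The rescaled value of the contour integral at the turning point. -/
noncomputable def edgeValue (n : ℕ) (r : ℝ) : ℝ := (2 * π)⁻¹ * (∫ v, edgeKernel n r v).re

lemma exists_abs_edgeValue_sub_le :
    ∃ K > 0, ∀ (n : ℕ) (r : ℝ), 0 < r → r ≤ 1 / 4 → ((n : ℝ) + 1 / 2) * r ^ 3 = 1 →
      |edgeValue n r - Ai 0| ≤ K * r ^ 2 := by
  obtain ⟨K, hK, h⟩ := exists_pow_le_exp_mul_sq 4 (c := 1) (a := 1 / 4) (by norm_num)
    (by norm_num)
  have hgi : Integrable fun v : ℝ => Real.exp (-(1 / 4) * v ^ 2) :=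
    integrable_exp_neg_mul_sq (by norm_num)
  refine ⟨(2 * π)⁻¹ * (10 * Real.exp 3 * (K * √(π / (1 / 4)))), by positivity,
    fun n r hr hr4 hnr => ?_⟩
  obtain ⟨hci, hc0⟩ := integral_airyWeight_mul_edgeCorrection
  have hai := integrable_airy_integrand 0 0
  simp only [Complex.ofReal_zero, mul_zero, Complex.exp_zero, mul_one, pow_zero, one_mul] at hai
  have hei : Integrable (edgeKernel n r) := by
    refine ((integrable_exp_neg_mul_sq (b := 1 / 2) (by norm_num)).const_mul
      (Real.exp (1 / 2))).mono' (continuous_edgeKernel n r).aestronglyMeasurable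
      (Eventually.of_forall fun v => ?_)
    refine (norm_edgeKernel_le hr (by linarith) hnr v).trans (le_of_eq ?_)
    ring_nf
  have hAi : Ai 0 = (2 * π)⁻¹ * (∫ v, airyWeight v).re := by
    rw [Ai_eq, airyMoment, lineMoment]
    simp
  have hdiff : ∫ v, edgeKernel n r v - airyWeight v * (1 - r * edgeCorrection v)
      = (∫ v, edgeKernel n r v) - ∫ v, airyWeight v := by
    have h1 : (fun v => airyWeight v * (1 - r * edgeCorrection v))
        = fun v => airyWeight v - r * (airyWeight v * edgeCorrection v) := by
      ext v; ring
    have h2 : Integrable (fun v => airyWeight v * (1 - r * edgeCorrection v)) := by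
      rw [h1]; exact hai.sub (hci.const_mul _)
    rw [integral_sub hei h2, h1, integral_sub hai (hci.const_mul _), integral_const_mul, hc0,
      mul_zero, sub_zero]
  have hb : ∀ v, ‖edgeKernel n r v - airyWeight v * (1 - r * edgeCorrection v)‖ ≤
      10 * Real.exp 3 * r ^ 2 * K * Real.exp (-(1 / 4) * v ^ 2) := by
    intro v
    refine (norm_edgeKernel_sub_le hr hr4 hnr v).trans ?_
    have h1 : ‖((1 : ℝ) : ℂ) + v * Complex.I‖ ^ 8 ≤ K * Real.exp (1 / 4 * v ^ 2) := by
      refine le_trans (le_of_eq ?_) (h v)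
      rw [show 8 = 2 * 4 from rfl, pow_mul, norm_line_sq, one_pow]
    have h2 : Real.exp (-(1 / 4) * v ^ 2) =
        Real.exp (1 / 4 * v ^ 2) * Real.exp (-(v ^ 2 / 2)) := by
      rw [← Real.exp_add]; ring_nf
    rw [h2]
    calc _ ≤ 10 * Real.exp 3 * r ^ 2 * (K * Real.exp (1 / 4 * v ^ 2) *
          Real.exp (-(v ^ 2 / 2))) := by gcongr
      _ = _ := by ring
  have hfin := norm_integral_le_of_norm_le (hgi.const_mul _) (Eventually.of_forall hb)
  rw [hdiff, integral_const_mul, integral_gaussian] at hfin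
  rw [edgeValue, hAi, ← mul_sub, ← Complex.sub_re, abs_mul,
    abs_of_pos (by positivity : 0 < (2 * π)⁻¹)]
  calc _ ≤ (2 * π)⁻¹ * (10 * Real.exp 3 * r ^ 2 * K * √(π / (1 / 4))) := by
        gcongr
        exact (Complex.abs_re_le_norm _).trans hfin
    _ = _ := by ring

lemma nonpos_of_deriv2_pos_of_pos {y y' y'' : ℝ → ℝ} {a l : ℝ}
    (hy : ∀ s, HasDerivAt y (y' s) s) (hy' : ∀ s, HasDerivAt y' (y'' s) s)
    (ha : y a ≤ 0) (hl : Tendsto y atTop (𝓝 l)) (hl0 : l ≤ 0)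
    (h : ∀ s, a < s → 0 < y s → 0 < y'' s) {s : ℝ} (hs : a ≤ s) : y s ≤ 0 := by
  by_contra! hpos
  have hcont : Continuous y := continuous_iff_continuousAt.2 fun x => (hy x).continuousAt
  obtain ⟨T, hT⟩ := ((hl.eventually (gt_mem_nhds (hl0.trans_lt hpos))).and
    (eventually_gt_atTop s)).exists
  obtain ⟨c, hc, hmax⟩ := isCompact_Icc.exists_isMaxOn
    (Set.nonempty_Icc.2 (hs.trans hT.2.le)) hcont.continuousOn
  have hcs : y s ≤ y c := hmax ⟨hs, hT.2.le⟩
  have hca : a < c := lt_of_le_of_ne hc.1 (by rintro rfl; linarith)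
  have hcT : c < T := lt_of_le_of_ne hc.2 (by rintro rfl; linarith [hT.1])
  have hlmax : IsLocalMax y c := hmax.isLocalMax (Icc_mem_nhds hca hcT)
  have hd : deriv y = y' := funext fun x => (hy x).deriv
  have hd' : deriv y' = y'' := funext fun x => (hy' x).deriv
  have hpos2 := h c hca (hpos.trans_le hcs)
  have hlmin : IsLocalMin y c := isLocalMin_of_deriv_deriv_pos (by rwa [hd, hd'])
    hlmax.deriv_eq_zero (hy c).continuousAt
  have heq : y =ᶠ[𝓝 c] fun _ => y c := by
    filter_upwards [hlmax, hlmin] with x h1 h2 using le_antisymm h1 h2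
  have h3 := heq.deriv.deriv_eq
  rw [hd, hd'] at h3
  simp at h3
  linarith

/-- Comparison with a supersolution `w` of `y'' = q y + f` on `[a, ∞)`. -/
lemma abs_le_of_supersolution {y y' q f w w' w'' : ℝ → ℝ} {a l : ℝ}
    (hy : ∀ s, HasDerivAt y (y' s) s) (hy' : ∀ s, HasDerivAt y' (q s * y s + f s) s)
    (hw : ∀ s, HasDerivAt w (w' s) s) (hw' : ∀ s, HasDerivAt w' (w'' s) s)
    (ha : |y a| ≤ w a) (hyl : Tendsto y atTop (𝓝 0)) (hwl : Tendsto w atTop (𝓝 l)) (hl : 0 ≤ l)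
    (hq : ∀ s, a < s → 0 < q s) (hf : ∀ s, a < s → w'' s + |f s| ≤ q s * w s)
    {s : ℝ} (hs : a ≤ s) : |y s| ≤ w s := by
  rw [abs_le'] at ha ⊢
  constructor
  · have := nonpos_of_deriv2_pos_of_pos (fun s => (hy s).sub (hw s))
      (fun s => (hy' s).sub (hw' s)) (by simpa using ha.1) (hyl.sub hwl) (by linarith)
      (fun s hs h => by
        have h1 := hf s hs
        have h2 := mul_pos (hq s hs) h
        simp only [Pi.sub_apply] at h2
        have h3 := neg_abs_le (f s)
        nlinarith) hs
    simpa using this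
  · have := nonpos_of_deriv2_pos_of_pos (fun s => (hy s).neg.sub (hw s))
      (fun s => (hy' s).neg.sub (hw' s)) (by simpa using ha.2) (hyl.neg.sub hwl) (by linarith)
      (fun s hs h => by
        have h1 := hf s hs
        have h2 := mul_pos (hq s hs) h
        simp only [Pi.sub_apply, Pi.neg_apply] at h2
        have h3 := le_abs_self (f s)
        nlinarith) hs
    simp only [Pi.sub_apply, Pi.neg_apply] at this
    linarith

lemma hasDerivAt_const_mul_exp (L c s : ℝ) :
    HasDerivAt (fun s => L * Real.exp (-c * s)) (L * -c * Real.exp (-c * s)) s := by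
  have := (((hasDerivAt_id s).const_mul (-c)).exp).const_mul L
  simp only [id, mul_one] at this
  exact this.congr_deriv (by ring)

lemma tendsto_const_mul_exp (L : ℝ) {c : ℝ} (hc : 0 < c) :
    Tendsto (fun s => L * Real.exp (-c * s)) atTop (𝓝 0) := by
  rw [← mul_zero L]
  refine Tendsto.const_mul _ (Real.tendsto_exp_atBot.comp ?_)
  exact tendsto_id.const_mul_atTop_of_neg (by linarith)

lemma abs_le_const_mul_exp {y y' q f : ℝ → ℝ} {a L c : ℝ}
    (hy : ∀ s, HasDerivAt y (y' s) s) (hy' : ∀ s, HasDerivAt y' (q s * y s + f s) s)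
    (hyl : Tendsto y atTop (𝓝 0)) (hL : 0 ≤ L) (hc : 0 ≤ c) (ha : |y a| ≤ L * Real.exp (-c * a))
    (hq : ∀ s, a < s → 0 < q s)
    (hf : ∀ s, a < s → L * c ^ 2 * Real.exp (-c * s) + |f s| ≤ q s * (L * Real.exp (-c * s)))
    {s : ℝ} (hs : a ≤ s) : |y s| ≤ L * Real.exp (-c * s) := by
  obtain ⟨l, hl, hwl⟩ : ∃ l, 0 ≤ l ∧ Tendsto (fun s => L * Real.exp (-c * s)) atTop (𝓝 l) := by
    rcases hc.eq_or_lt with rfl | hc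
    · exact ⟨L, hL, by simp⟩
    · exact ⟨0, le_rfl, tendsto_const_mul_exp L hc⟩
  refine abs_le_of_supersolution hy hy' (hasDerivAt_const_mul_exp L c)
    (hasDerivAt_const_mul_exp (L * -c) c) ha hyl hwl hl hq (fun s hs => ?_) hs
  refine le_trans (le_of_eq ?_) (hf s hs)
  ring

lemma abs_le_of_abs_deriv_le_exp {z g : ℝ → ℝ} {a A c : ℝ} (hc : 0 < c)
    (hz : ∀ s, HasDerivAt z (g s) s) (hzl : Tendsto z atTop (𝓝 0))
    (hg : ∀ s, a ≤ s → |g s| ≤ A * Real.exp (-c * s)) {s : ℝ} (hs : a ≤ s) :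
    |z s| ≤ A / c * Real.exp (-c * s) := by
  have key : ∀ σ : ℝ, |σ| = 1 → 0 ≤ σ * z s + A / c * Real.exp (-c * s) := by
    intro σ hσ
    have hd : ∀ t, HasDerivAt (fun t => σ * z t + A / c * Real.exp (-c * t))
        (σ * g t + A / c * -c * Real.exp (-c * t)) t := fun t =>
      ((hz t).const_mul σ).add (hasDerivAt_const_mul_exp _ _ _)
    have hanti : AntitoneOn (fun t => σ * z t + A / c * Real.exp (-c * t)) (Set.Ici a) := by
      refine antitoneOn_of_deriv_nonpos (convex_Ici a)
        (fun t _ => (hd t).continuousAt.continuousWithinAt)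
        (fun t _ => (hd t).differentiableAt.differentiableWithinAt) fun t ht => ?_
      rw [interior_Ici] at ht
      rw [(hd t).deriv]
      have h1 := hg t (le_of_lt ht)
      have h2 : A / c * -c = -A := by field_simp
      have h3 : σ * g t ≤ |g t| := by
        have := le_abs_self (σ * g t)
        rwa [abs_mul, hσ, one_mul] at this
      rw [h2]
      linarith
    have hlim : Tendsto (fun t => σ * z t + A / c * Real.exp (-c * t)) atTop (𝓝 0) := by
      have := (hzl.const_mul σ).add (tendsto_const_mul_exp (A / c) hc)
      simpa using this
    refine le_of_tendsto hlim ?_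
    filter_upwards [eventually_ge_atTop s] with t ht
    exact hanti hs (hs.trans ht) ht
  have h1 := key 1 (by simp)
  have h2 := key (-1) (by simp)
  rw [abs_le]
  constructor <;> linarith

/-- Grönwall estimate for `|y''| ≤ Q |y| + P`, integrating backwards from `0`. -/
lemma abs_le_of_abs_deriv2_le {y y' g : ℝ → ℝ} {R Q P : ℝ} (hQ : 0 ≤ Q)
    (hy : ∀ s, HasDerivAt y (y' s) s) (hy' : ∀ s, HasDerivAt y' (g s) s)
    (h0 : |y 0| ≤ P) (h0' : |y' 0| ≤ P)
    (hg : ∀ s, -R ≤ s → s ≤ 0 → |g s| ≤ Q * |y s| + P) {s : ℝ} (hs : -R ≤ s) (hs0 : s ≤ 0) :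
    |y s| ≤ 2 * Real.exp ((Q + 2) * R) * P ∧ |y' s| ≤ 2 * Real.exp ((Q + 2) * R) * P := by
  have hP : 0 ≤ P := (abs_nonneg _).trans h0
  have hd : ∀ t, HasDerivAt (fun t => (y t ^ 2 + y' t ^ 2 + P ^ 2) * Real.exp ((Q + 2) * t))
      (((2 * y t * y' t + 2 * y' t * g t) + (y t ^ 2 + y' t ^ 2 + P ^ 2) * (Q + 2)) *
        Real.exp ((Q + 2) * t)) t := by
    intro t
    have h1 := (((hy t).pow 2).add ((hy' t).pow 2)).add_const (P ^ 2)
    have h2 := ((hasDerivAt_id t).const_mul (Q + 2)).exp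
    refine (h1.mul h2).congr_deriv ?_
    simp only [id, Pi.add_apply, Pi.pow_apply]
    push_cast
    ring
  have hmono : MonotoneOn (fun t => (y t ^ 2 + y' t ^ 2 + P ^ 2) * Real.exp ((Q + 2) * t))
      (Set.Icc (-R) 0) := by
    refine monotoneOn_of_deriv_nonneg (convex_Icc _ _)
      (fun t _ => (hd t).continuousAt.continuousWithinAt)
      (fun t _ => (hd t).differentiableAt.differentiableWithinAt) fun t ht => ?_
    rw [interior_Icc] at ht
    rw [(hd t).deriv]
    refine mul_nonneg ?_ (Real.exp_nonneg _)
    have h1 := hg t ht.1.le ht.2.le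
    have h2 : -(|y' t| * (Q * |y t| + P)) ≤ y' t * g t := by
      have := neg_abs_le (y' t * g t)
      rw [abs_mul] at this
      nlinarith [mul_le_mul_of_nonneg_left h1 (abs_nonneg (y' t))]
    have h3 := sq_abs (y t)
    have h4 := sq_abs (y' t)
    have h5 : -(|y' t| * |y t|) ≤ y t * y' t := by
      have := neg_abs_le (y t * y' t)
      rw [abs_mul] at this
      linarith
    rw [← h3, ← h4]
    nlinarith [mul_nonneg hQ (sq_nonneg (|y t| - |y' t|)), sq_nonneg (|y t| - |y' t|),
      sq_nonneg (|y' t| - P), mul_nonneg hQ (sq_nonneg P), sq_nonneg (|y t|)]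
  have h1 := hmono ⟨hs, hs0⟩ ⟨hs.trans hs0, le_rfl⟩ hs0
  simp only [mul_zero, Real.exp_zero, mul_one] at h1
  set E := Real.exp ((Q + 2) * R) with hE
  have hE1 : 1 ≤ E := Real.one_le_exp (mul_nonneg (by linarith) (by linarith))
  have h2 : y 0 ^ 2 ≤ P ^ 2 := sq_le_sq' (abs_le.1 h0).1 (abs_le.1 h0).2
  have h3 : y' 0 ^ 2 ≤ P ^ 2 := sq_le_sq' (abs_le.1 h0').1 (abs_le.1 h0').2
  have h4 : y s ^ 2 + y' s ^ 2 + P ^ 2 ≤ E * (3 * P ^ 2) := by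
    have h5 : 1 ≤ E * Real.exp ((Q + 2) * s) := by
      rw [hE, ← Real.exp_add]
      exact Real.one_le_exp (by nlinarith)
    calc y s ^ 2 + y' s ^ 2 + P ^ 2
        ≤ (y s ^ 2 + y' s ^ 2 + P ^ 2) * (E * Real.exp ((Q + 2) * s)) :=
          le_mul_of_one_le_right (by positivity) h5
      _ = E * ((y s ^ 2 + y' s ^ 2 + P ^ 2) * Real.exp ((Q + 2) * s)) := by ring
      _ ≤ E * (3 * P ^ 2) := mul_le_mul_of_nonneg_left (by linarith) (by positivity)
  have h6 : E * (3 * P ^ 2) ≤ (2 * E * P) ^ 2 := by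
    nlinarith [mul_nonneg (sub_nonneg.2 hE1) (mul_nonneg (zero_le_one.trans hE1) (sq_nonneg P)),
      mul_nonneg (zero_le_one.trans hE1) (sq_nonneg P)]
  constructor <;> refine abs_le_of_sq_le_sq ?_ (by positivity) <;> nlinarith [sq_nonneg (y s),
    sq_nonneg (y' s), sq_nonneg P]

section PerturbedAiry

variable {G G' : ℝ → ℝ} {κ ε M δ : ℝ}

lemma abs_le_exp_of_perturbedAiry (hκ : 1 / 2 ≤ κ) (hε : 0 ≤ ε)
    (hG : ∀ s, HasDerivAt G (G' s) s)
    (hG' : ∀ s, HasDerivAt G' ((κ * s + ε * s ^ 2) * G s) s) (hGl : Tendsto G atTop (𝓝 0))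
    (hM : |G 0| ≤ M) {s : ℝ} (hs : 0 ≤ s) : |G s| ≤ M * Real.exp 16 * Real.exp (-2 * s) := by
  have hM0 : 0 ≤ M := (abs_nonneg _).trans hM
  have hG'' : ∀ s, HasDerivAt G' ((κ * s + ε * s ^ 2) * G s + 0) s := by simpa using hG'
  have hq : ∀ s : ℝ, 0 < s → 0 < κ * s + ε * s ^ 2 := fun s hs => by positivity
  have h1 : ∀ s, 0 ≤ s → |G s| ≤ M := by
    intro s hs
    have := abs_le_const_mul_exp (a := 0) (L := M) (c := 0) (f := fun _ => 0) hG hG'' hGl hM0 le_rfl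
      (by simpa using hM) hq (fun s hs => by
        have := hq s hs
        simp only [neg_zero, zero_mul, Real.exp_zero, mul_one, abs_zero, add_zero]
        nlinarith [mul_nonneg this.le hM0]) hs
    simpa using this
  rcases le_or_gt s 8 with h8 | h8
  · refine (h1 s hs).trans ?_
    rw [mul_assoc, ← Real.exp_add]
    exact le_mul_of_one_le_right hM0 (Real.one_le_exp (by linarith))
  · refine abs_le_const_mul_exp (a := 8) (c := 2) (f := fun _ => 0) hG hG'' hGl (by positivity)
      (by norm_num) ?_ (fun s hs => hq s (by linarith)) (fun s hs => ?_) h8.le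
    · rw [mul_assoc, ← Real.exp_add]
      norm_num
      exact h1 8 (by norm_num)
    · have h4 : 4 ≤ κ * s + ε * s ^ 2 := by nlinarith [mul_nonneg hε (sq_nonneg s)]
      rw [abs_zero, add_zero]
      calc _ = 4 * (M * Real.exp 16 * Real.exp (-2 * s)) := by ring
        _ ≤ _ := mul_le_mul_of_nonneg_right h4 (by positivity)

lemma sq_add_two_mul_le_exp {s : ℝ} (hs : 0 ≤ s) : s ^ 2 + 2 * s ≤ 2 * Real.exp s := by
  linarith [Real.quadratic_le_exp_of_nonneg hs]

lemma abs_deriv_le_exp_of_perturbedAiry (hκ : 1 / 2 ≤ κ) (hκ2 : κ ≤ 2) (hε : 0 ≤ ε) (hε1 : ε ≤ 1)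
    (hG : ∀ s, HasDerivAt G (G' s) s)
    (hG' : ∀ s, HasDerivAt G' ((κ * s + ε * s ^ 2) * G s) s) (hGl : Tendsto G atTop (𝓝 0))
    (hGl' : Tendsto G' atTop (𝓝 0))
    (hM : |G 0| ≤ M) {s : ℝ} (hs : 0 ≤ s) : |G' s| ≤ 2 * M * Real.exp 16 * Real.exp (-s) := by
  have := abs_le_of_abs_deriv_le_exp (a := 0) (A := 2 * M * Real.exp 16) (c := 1) one_pos hG' hGl'
    (fun s hs => ?_) hs
  · simpa using this
  · have h1 := abs_le_exp_of_perturbedAiry hκ hε hG hG' hGl hM hs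
    have h2 : |κ * s + ε * s ^ 2| ≤ 2 * Real.exp s := by
      rw [abs_of_nonneg (by positivity)]
      nlinarith [sq_add_two_mul_le_exp hs, mul_le_mul_of_nonneg_right hε1 (sq_nonneg s)]
    rw [abs_mul]
    calc _ ≤ 2 * Real.exp s * (M * Real.exp 16 * Real.exp (-2 * s)) := by gcongr
      _ = 2 * M * Real.exp 16 * (Real.exp s * Real.exp (-2 * s)) := by ring
      _ = _ := by rw [← Real.exp_add]; ring_nf

lemma abs_perturbation_le (hε : 0 ≤ ε) (hκδ : |κ - 1| ≤ δ) (hεδ : ε ≤ δ) (s : ℝ) :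
    |((κ - 1) * s + ε * s ^ 2) * G s| ≤ δ * (|s| * (1 + |s|)) * |G s| := by
  rw [abs_mul]
  gcongr
  refine (abs_add_le _ _).trans ?_
  rw [abs_mul, abs_mul, abs_of_nonneg hε, abs_pow]
  nlinarith [mul_le_mul_of_nonneg_right hκδ (abs_nonneg s),
    mul_le_mul_of_nonneg_right hεδ (sq_nonneg |s|)]

variable {A A' : ℝ → ℝ}

lemma hasDerivAt_perturbedAiry_sub (hG' : ∀ s, HasDerivAt G' ((κ * s + ε * s ^ 2) * G s) s)
    (hA' : ∀ s, HasDerivAt A' (s * A s) s) (s : ℝ) :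
    HasDerivAt (G' - A') (s * (G - A) s + ((κ - 1) * s + ε * s ^ 2) * G s) s := by
  refine ((hG' s).sub (hA' s)).congr_deriv ?_
  simp only [Pi.sub_apply]
  ring

lemma abs_sub_le_exp_of_perturbedAiry (hκ : 1 / 2 ≤ κ) (hε : 0 ≤ ε)
    (hκδ : |κ - 1| ≤ δ) (hεδ : ε ≤ δ)
    (hG : ∀ s, HasDerivAt G (G' s) s)
    (hG' : ∀ s, HasDerivAt G' ((κ * s + ε * s ^ 2) * G s) s) (hGl : Tendsto G atTop (𝓝 0))
    (hGl' : Tendsto G' atTop (𝓝 0)) (hM : |G 0| ≤ M)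
    (hA : ∀ s, HasDerivAt A (A' s) s) (hA' : ∀ s, HasDerivAt A' (s * A s) s)
    (hAl : Tendsto A atTop (𝓝 0)) (hAl' : Tendsto A' atTop (𝓝 0)) (h0 : |G 0 - A 0| ≤ δ)
    {s : ℝ} (hs : 0 ≤ s) :
    |G s - A s| ≤ 2 * Real.exp 2 * (1 + M * Real.exp 16) * δ * Real.exp (-s) ∧
    |G' s - A' s| ≤ 16 * Real.exp 2 * (1 + M * Real.exp 16) * δ * Real.exp (-s / 2) := by
  have hM0 : 0 ≤ M := (abs_nonneg _).trans hM
  have hδ : 0 ≤ δ := hε.trans hεδ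
  set f : ℝ → ℝ := fun s => ((κ - 1) * s + ε * s ^ 2) * G s with hf
  set B := M * Real.exp 16 * δ with hB
  set L := δ + B with hL
  have hB0 : 0 ≤ B := by positivity
  have hL0 : 0 ≤ L := by positivity
  have hD : ∀ s, HasDerivAt (G - A) ((G' - A') s) s := fun s => (hG s).sub (hA s)
  have hD' : ∀ s, HasDerivAt (G' - A') (s * (G - A) s + f s) s :=
    hasDerivAt_perturbedAiry_sub hG' hA'
  have hDl : Tendsto (G - A) atTop (𝓝 0) := by
    rw [← sub_zero (0 : ℝ)]
    exact hGl.sub hAl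
  have hDl' : Tendsto (G' - A') atTop (𝓝 0) := by
    rw [← sub_zero (0 : ℝ)]
    exact hGl'.sub hAl'
  have hfb : ∀ s, 0 ≤ s → |f s| ≤ s * (B * Real.exp (-s)) := by
    intro s hs
    refine (abs_perturbation_le hε hκδ hεδ s).trans ?_
    rw [abs_of_nonneg hs]
    have h1 := abs_le_exp_of_perturbedAiry hκ hε hG hG' hGl hM hs
    have h2 : 1 + s ≤ Real.exp s := by linarith [Real.add_one_le_exp s]
    calc _ ≤ δ * (s * Real.exp s) * (M * Real.exp 16 * Real.exp (-2 * s)) := by gcongr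
      _ = s * (B * (Real.exp s * Real.exp (-2 * s))) := by rw [hB]; ring
      _ = _ := by rw [← Real.exp_add]; ring_nf
  have h1 : ∀ s, 0 ≤ s → |(G - A) s| ≤ L := by
    intro s hs
    have := abs_le_const_mul_exp (a := 0) (L := L) (c := 0) hD hD' hDl hL0 le_rfl
      (by simpa using h0.trans (by linarith)) (fun s hs => hs) (fun s hs => by
        simp only [neg_zero, zero_mul, Real.exp_zero, mul_one]
        have h2 : Real.exp (-s) ≤ 1 := Real.exp_le_one_iff.2 (by linarith)
        have h3 := hfb s hs.le
        have h4 : s * (B * Real.exp (-s)) ≤ s * L := by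
          gcongr
          nlinarith
        linarith) hs
    simpa using this
  have hL2 : 2 * Real.exp 2 * (1 + M * Real.exp 16) * δ = 2 * Real.exp 2 * L := by
    rw [hL, hB]; ring
  have h2 : ∀ s, 0 ≤ s → |(G - A) s| ≤ 2 * Real.exp 2 * L * Real.exp (-1 * s) := by
    intro s hs
    have hb : ∀ s ≤ 2, L ≤ 2 * Real.exp 2 * L * Real.exp (-1 * s) := by
      intro s hs
      have h3 : 1 ≤ Real.exp 2 * Real.exp (-1 * s) := by
        rw [← Real.exp_add]
        exact Real.one_le_exp (by linarith)
      nlinarith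
    rcases le_or_gt s 2 with h3 | h3
    · exact (h1 s hs).trans (hb s h3)
    · refine abs_le_const_mul_exp (a := 2) (c := 1) hD hD' hDl (by positivity) zero_le_one
        ((h1 2 (by norm_num)).trans (hb 2 le_rfl)) (fun s hs => by linarith) (fun s hs => ?_) h3.le
      have h4 := hfb s (by linarith)
      rw [show (-1 : ℝ) * s = -s by ring]
      have h5 : B ≤ Real.exp 2 * L := by nlinarith [Real.one_le_exp (x := 2) (by norm_num)]
      have h6 : s * (B * Real.exp (-s)) ≤ s * (Real.exp 2 * L * Real.exp (-s)) := by
        gcongr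
      have h7 : 0 ≤ Real.exp 2 * L * Real.exp (-s) := by positivity
      nlinarith
  rw [hL2]
  constructor
  · simpa using h2 s hs
  · have h3 := abs_le_of_abs_deriv_le_exp (a := 0) (A := 8 * Real.exp 2 * L) (c := 1 / 2)
      (by norm_num) hD' hDl' (fun s hs => ?_) hs
    · refine (le_of_eq_of_le rfl h3).trans (le_of_eq ?_)
      rw [show -(1 / 2) * s = -s / 2 by ring, hL, hB]
      ring
    · refine (abs_add_le _ _).trans ?_
      have h4 := h2 s hs
      have h5 := hfb s hs
      rw [show (-1 : ℝ) * s = -s by ring] at h4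
      have h6 : B ≤ 2 * Real.exp 2 * L := by nlinarith [Real.one_le_exp (x := 2) (by norm_num)]
      have h7 : s ≤ 2 * Real.exp (s / 2) := by linarith [Real.add_one_le_exp (s / 2)]
      rw [abs_mul, abs_of_nonneg hs]
      calc _ ≤ s * (2 * Real.exp 2 * L * Real.exp (-s)) +
            s * (2 * Real.exp 2 * L * Real.exp (-s)) := by
            refine add_le_add (by gcongr) (h5.trans (by gcongr))
        _ = s * (4 * Real.exp 2 * L * Real.exp (-s)) := by ring
        _ ≤ 2 * Real.exp (s / 2) * (4 * Real.exp 2 * L * Real.exp (-s)) := by gcongr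
        _ = 8 * Real.exp 2 * L * (Real.exp (s / 2) * Real.exp (-s)) := by ring
        _ = _ := by rw [← Real.exp_add]; ring_nf

/-- Solutions of `G'' = (κ s + ε s²) G` decaying at infinity are close to decaying solutions of
the Airy equation when `κ - 1` and `ε` are small. -/
lemma exists_perturbedAiry_bounds (hM : 0 < M) {R : ℝ} (hR : 0 ≤ R) :
    ∃ C > 0, ∀ {G G' A A' : ℝ → ℝ} {κ ε δ : ℝ}, 1 / 2 ≤ κ → κ ≤ 2 → 0 ≤ ε → ε ≤ 1 →
      |κ - 1| ≤ δ → ε ≤ δ →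
      (∀ s, HasDerivAt G (G' s) s) → (∀ s, HasDerivAt G' ((κ * s + ε * s ^ 2) * G s) s) →
      Tendsto G atTop (𝓝 0) → Tendsto G' atTop (𝓝 0) → |G 0| ≤ M →
      (∀ s, HasDerivAt A (A' s) s) → (∀ s, HasDerivAt A' (s * A s) s) →
      Tendsto A atTop (𝓝 0) → Tendsto A' atTop (𝓝 0) → |G 0 - A 0| ≤ δ →
      ∀ s, -R ≤ s → |G' s| ≤ C * Real.exp (-s) ∧ |G' s - A' s| ≤ C * δ * Real.exp (-s / 2) := by
  set P₁ := 2 * M * Real.exp 16 with hP₁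
  set E := 2 * Real.exp ((2 * R + R ^ 2 + 2) * R) with hE
  set P₂ := 16 * Real.exp 2 * (1 + M * Real.exp 16) with hP₂
  set P₃ := P₂ + R * (1 + R) * (E * P₁) with hP₃
  have hP₁0 : 0 < P₁ := by positivity
  have hP₂0 : 0 < P₂ := by positivity
  have hE1 : 1 ≤ E := by
    have := Real.one_le_exp (x := (2 * R + R ^ 2 + 2) * R) (by positivity)
    linarith
  have hP₃0 : 0 < P₃ := by positivity
  have hMP : M ≤ P₁ := by nlinarith [Real.one_le_exp (x := 16) (by norm_num)]
  refine ⟨E * P₁ + E * P₃, by positivity, ?_⟩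
  intro G G' A A' κ ε δ hκ hκ2 hε hε1 hκδ hεδ hG hG' hGl hGl' hGM hA hA' hAl hAl' h0 s hs
  have hδ : 0 ≤ δ := hε.trans hεδ
  have hp1 := fun {s : ℝ} (hs : 0 ≤ s) =>
    abs_deriv_le_exp_of_perturbedAiry hκ hκ2 hε hε1 hG hG' hGl hGl' hGM hs
  have hp2 := fun {s : ℝ} (hs : 0 ≤ s) =>
    abs_sub_le_exp_of_perturbedAiry hκ hε hκδ hεδ hG hG' hGl hGl' hGM hA hA' hAl hAl' h0 hs
  have hEP₁ : P₁ ≤ E * P₁ := le_mul_of_one_le_left hP₁0.le hE1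
  have hEP₃ : P₃ ≤ E * P₃ := le_mul_of_one_le_left hP₃0.le hE1
  have hP₂₃ : P₂ ≤ P₃ := by
    rw [hP₃]
    have : 0 ≤ R * (1 + R) * (E * P₁) := by positivity
    linarith
  rcases le_or_gt 0 s with hs0 | hs0
  · refine ⟨(hp1 hs0).trans ?_, (hp2 hs0).2.trans ?_⟩
    · gcongr
      linarith [mul_nonneg (zero_le_one.trans hE1) hP₃0.le]
    · gcongr
      linarith [mul_nonneg (zero_le_one.trans hE1) hP₁0.le]
  · have hneg : ∀ t, -R ≤ t → t ≤ 0 → |t| ≤ R := fun t h1 h2 => by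
      rw [abs_of_nonpos h2]; linarith
    have hback : ∀ t, -R ≤ t → t ≤ 0 → |G t| ≤ E * P₁ ∧ |G' t| ≤ E * P₁ := by
      intro t ht ht0
      refine abs_le_of_abs_deriv2_le (Q := 2 * R + R ^ 2) (by positivity) hG hG'
        (hGM.trans hMP) (by simpa using hp1 le_rfl) (fun s h1 h2 => ?_) ht ht0
      rw [abs_mul]
      have h3 := hneg s h1 h2
      have h4 : |κ * s + ε * s ^ 2| ≤ 2 * R + R ^ 2 := by
        refine (abs_add_le _ _).trans ?_
        rw [abs_mul, abs_mul, abs_of_nonneg hε, abs_of_nonneg (by linarith : 0 ≤ κ), abs_pow]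
        have h5 : κ * |s| ≤ 2 * R := by gcongr
        have h6 : ε * |s| ^ 2 ≤ 1 * R ^ 2 := by gcongr
        linarith
      have h5 := mul_le_mul_of_nonneg_right h4 (abs_nonneg (G s))
      linarith
    have hdiff : |(G' - A') s| ≤ E * (P₃ * δ) := by
      have hP₂δ : P₂ * δ ≤ P₃ * δ := by gcongr
      have hp20 := hp2 le_rfl
      simp only [neg_zero, zero_div, Real.exp_zero, mul_one] at hp20
      refine (abs_le_of_abs_deriv2_le (y := G - A) (Q := 2 * R + R ^ 2) (by positivity)
        (fun s => (hG s).sub (hA s)) (hasDerivAt_perturbedAiry_sub hG' hA') ?_ ?_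
        (fun t h1 h2 => ?_) hs hs0.le).2
      · refine (h0.trans ?_).trans hP₂δ
        refine le_mul_of_one_le_left hδ ?_
        rw [hP₂]
        have h1 := Real.one_le_exp (x := 2) (by norm_num)
        have h2 : 0 ≤ M * Real.exp 16 := by positivity
        nlinarith
      · exact hp20.2.trans hP₂δ
      · have h3 := hneg t h1 h2
        have h4 : |((κ - 1) * t + ε * t ^ 2) * G t| ≤ P₃ * δ := by
          refine (abs_perturbation_le hε hκδ hεδ t).trans ?_
          have h5 := (hback t h1 h2).1
          calc _ ≤ δ * (R * (1 + R)) * (E * P₁) := by gcongr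
            _ = R * (1 + R) * (E * P₁) * δ := by ring
            _ ≤ P₃ * δ := by
              gcongr
              rw [hP₃]
              linarith
        have h5 : |t * (G - A) t| ≤ (2 * R + R ^ 2) * |(G - A) t| := by
          rw [abs_mul]
          gcongr
          nlinarith [sq_nonneg R]
        exact (abs_add_le _ _).trans (add_le_add h5 h4)
    constructor
    · refine (hback s hs hs0.le).2.trans ?_
      have h1 : 1 ≤ Real.exp (-s) := Real.one_le_exp (by linarith)
      nlinarith
    · refine le_trans (show |G' s - A' s| ≤ E * (P₃ * δ) from hdiff) ?_
      have h1 : 1 ≤ Real.exp (-s / 2) := Real.one_le_exp (by linarith)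
      calc E * (P₃ * δ) = E * P₃ * δ * 1 := by ring
        _ ≤ (E * P₁ + E * P₃) * δ * Real.exp (-s / 2) := by
          gcongr
          linarith

end PerturbedAiry

lemma log_stirlingSeq_bounds {n : ℕ} (hn : n ≠ 0) :
    0 ≤ Real.log (Stirling.stirlingSeq n) - Real.log π / 2 ∧
      Real.log (Stirling.stirlingSeq n) - Real.log π / 2 ≤ 1 / (12 * n) := by
  have hπ : Real.log √π = Real.log π / 2 := Real.log_sqrt pi_pos.le
  have hlim : Tendsto (fun k : ℕ => Real.log (Stirling.stirlingSeq k)) atTop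
      (𝓝 (Real.log π / 2)) := by
    rw [← hπ]
    exact (Stirling.tendsto_stirlingSeq_sqrt_pi).log (by positivity)
  constructor
  · rw [← hπ, sub_nonneg]
    exact Real.log_le_log (by positivity) (Stirling.sqrt_pi_le_stirlingSeq hn)
  · have hmono : ∀ k, n ≤ k → Real.log (Stirling.stirlingSeq n) - 1 / (12 * n) ≤
        Real.log (Stirling.stirlingSeq k) - 1 / (12 * k) := by
      intro k hk
      induction k, hk using Nat.le_induction with
      | base => exact le_rfl
      | succ k hk ih =>
        refine ih.trans ?_
        have h := Stirling.log_stirlingSeq_sdiff_le k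
        have hk0 : (k : ℝ) ≠ 0 := by
          have : 0 < k := (Nat.pos_of_ne_zero hn).trans_le hk
          positivity
        have h2 : (1 : ℝ) / (12 * k * (k + 1)) = 1 / (12 * k) - 1 / (12 * (k + 1)) := by
          field_simp
          ring
        push_cast
        linarith
    have h0 : Tendsto (fun k : ℕ => (1 : ℝ) / (12 * k)) atTop (𝓝 0) :=
      tendsto_const_nhds.div_atTop (tendsto_natCast_atTop_atTop.const_mul_atTop (by norm_num))
    have h1 := ge_of_tendsto (hlim.sub h0) (eventually_atTop.2 ⟨n, hmono⟩)
    linarith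

/-- Ratio between the rescaled oscillator function at the turning point and `edgeValue`. -/
noncomputable def edgeFactor (N j : ℕ) : ℝ :=
  (2 * N : ℝ) ^ ((1 : ℝ) / 4) * tauN N * (hNorm j ^ (-(1 : ℝ) / 2) * 2 ^ j / √π *
    Real.exp ((j : ℝ) + 1 / 2) * ((√(2 * j + 1) / 2) ^ (j + 1) * ((j : ℝ) + 1 / 2) ^ (-(1 : ℝ) / 3) *
      Real.exp (-(3 / 2) * (j + 1 / 2)))) * (2 * π)

lemma osc_turning_point (N j : ℕ) :
    (2 * N : ℝ) ^ ((1 : ℝ) / 4) * tauN N * osc j √(2 * j + 1) =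
      edgeFactor N j * edgeValue j (((j : ℝ) + 1 / 2) ^ (-(1 : ℝ) / 3)) := by
  have hu2 : √(2 * j + 1 : ℝ) ^ 2 = 2 * j + 1 := Real.sq_sqrt (by positivity)
  set r := ((j : ℝ) + 1 / 2) ^ (-(1 : ℝ) / 3) with hr
  have hr0 : 0 < r := by positivity
  rw [osc_eq_lineMoment (√(2 * j + 1) / 2 * (1 + r)),
    lineMoment_turning_point j hr0 (by positivity) hu2, Complex.re_ofReal_mul, edgeFactor,
    edgeValue, ← hr, hu2, show ((2 * j + 1 : ℝ)) / 2 = j + 1 / 2 by ring]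
  field_simp

lemma log_edgeFactor {N j : ℕ} (hN : N ≠ 0) (hj : j ≠ 0) :
    0 < edgeFactor N j ∧ Real.log (edgeFactor N j) =
      (1 / 6 * (Real.log N - Real.log (j + 1 / 2)) -
        (Real.log (Stirling.stirlingSeq j) - Real.log π / 2) +
        (j + 1 / 2) * (Real.log (j + 1 / 2) - Real.log j) - 1 / 2) / 2 := by
  have hj0 : (0 : ℝ) < j := by positivity
  have hm : (0 : ℝ) < (j : ℝ) + 1 / 2 := by positivity
  have hf : (0 : ℝ) < j.factorial := by positivity
  have hh : 0 < hNorm j := by rw [hNorm]; positivity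
  have hpi := pi_pos
  have hspi : 0 < √π := by positivity
  constructor
  · rw [edgeFactor, tauN]; positivity
  have hlu : Real.log √(2 * j + 1 : ℝ) = (Real.log 2 + Real.log (j + 1 / 2)) / 2 := by
    rw [Real.log_sqrt (by positivity), ← Real.log_mul (by norm_num) hm.ne']
    ring_nf
  have hlh : Real.log (hNorm j) = Real.log π / 2 + j * Real.log 2 + Real.log j.factorial := by
    rw [hNorm, Real.log_mul (by positivity) hf.ne', Real.log_mul hspi.ne' (by positivity),
      Real.log_sqrt hpi.le, Real.log_pow]
  have hst := Stirling.log_stirlingSeq_formula j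
  rw [Real.log_mul two_ne_zero hj0.ne', Real.log_div hj0.ne' (Real.exp_ne_zero _),
    Real.log_exp] at hst
  rw [hst, edgeFactor, tauN]
  rw [Real.log_mul (by positivity) (by positivity), Real.log_mul (by positivity) (by positivity),
    Real.log_mul (by positivity) (by positivity), Real.log_mul (by positivity) (by positivity),
    Real.log_mul (by positivity) (by positivity), Real.log_mul (by positivity) (by positivity),
    Real.log_mul (by positivity) (by positivity), Real.log_mul (by positivity) (by positivity),
    Real.log_div (by positivity) (by positivity), Real.log_mul (by positivity) (by positivity),
    Real.log_rpow (by positivity), Real.log_rpow (by positivity), Real.log_rpow (by positivity),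
    Real.log_rpow (by positivity), Real.log_rpow (by positivity),
    Real.log_mul (by positivity) (by positivity), Real.log_exp, Real.log_exp, Real.log_pow,
    Real.log_pow, Real.log_div (by positivity) (by positivity), Real.log_sqrt hpi.le, hlu, hlh,
    Real.log_mul two_ne_zero hpi.ne']
  push_cast
  ring

lemma abs_edgeFactor_sub_one_le {N j : ℕ} (hj : j ≠ 0) (hjN : j ≤ N) (hNj : N ≤ j + 1) :
    |edgeFactor N j - 1| ≤ 1 / j := by
  have hN : N ≠ 0 := by omega
  have hN0 : (0 : ℝ) < N := by positivity
  have hj0 : (0 : ℝ) < j := by positivity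
  have hj1 : (1 : ℝ) ≤ j := by exact_mod_cast Nat.one_le_iff_ne_zero.2 hj
  have hm : (0 : ℝ) < (j : ℝ) + 1 / 2 := by positivity
  have hjN' : (j : ℝ) ≤ N := by exact_mod_cast hjN
  have hNj' : (N : ℝ) ≤ j + 1 := by exact_mod_cast hNj
  obtain ⟨hpos, hlog⟩ := log_edgeFactor hN hj
  obtain ⟨h1, h2⟩ := log_stirlingSeq_bounds hj
  set t : ℝ := 1 / j with ht
  have h2' : (1 : ℝ) / (12 * j) = t / 12 := by rw [ht]; field_simp
  rw [h2'] at h2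
  have h3 : Real.log N - Real.log (j + 1 / 2) ≤ t / 2 := by
    rw [← Real.log_div hN0.ne' hm.ne']
    refine (Real.log_le_sub_one_of_pos (by positivity)).trans ?_
    rw [ht, div_sub_one hm.ne', div_div, div_le_div_iff₀ hm (by positivity)]
    nlinarith
  have h4 : Real.log (j + 1 / 2) - Real.log N ≤ t / 2 := by
    rw [← Real.log_div hm.ne' hN0.ne']
    refine (Real.log_le_sub_one_of_pos (by positivity)).trans ?_
    rw [ht, div_sub_one hN0.ne', div_div, div_le_div_iff₀ hN0 (by positivity)]
    nlinarith
  have h5 : (j + 1 / 2) * (Real.log (j + 1 / 2) - Real.log j) ≤ 1 / 2 + t / 4 := by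
    have h6 : Real.log (j + 1 / 2) - Real.log j ≤ t / 2 := by
      rw [← Real.log_div hm.ne' hj0.ne']
      refine (Real.log_le_sub_one_of_pos (by positivity)).trans (le_of_eq ?_)
      rw [ht]
      field_simp
      ring
    calc _ ≤ ((j : ℝ) + 1 / 2) * (t / 2) := by gcongr
      _ = _ := by rw [ht]; field_simp; ring
  have h7 : 1 / 2 ≤ (j + 1 / 2) * (Real.log (j + 1 / 2) - Real.log j) := by
    have h6 : Real.log j - Real.log (j + 1 / 2) ≤ -(1 / 2) / (j + 1 / 2) := by
      rw [← Real.log_div hj0.ne' hm.ne']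
      refine (Real.log_le_sub_one_of_pos (by positivity)).trans (le_of_eq ?_)
      field_simp
      ring
    rw [le_div_iff₀ hm] at h6
    linarith
  have h8 : |Real.log (edgeFactor N j)| ≤ t / 2 := by
    rw [abs_le, hlog]
    constructor <;> linarith
  have ht1 : t ≤ 1 := by rw [ht, div_le_one hj0]; exact hj1
  have h9 := Real.abs_exp_sub_one_le (h8.trans (by linarith))
  rw [Real.exp_log hpos] at h9
  linarith

lemma tauN_pow_six {N : ℕ} (hN : N ≠ 0) : tauN N ^ 6 = 1 / (8 * N) := by
  have hN0 : (0 : ℝ) < N := by positivity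
  rw [tauN, mul_pow, ← Real.rpow_natCast, ← Real.rpow_natCast (_ ^ _), ← Real.rpow_mul (by norm_num),
    ← Real.rpow_mul hN0.le]
  norm_num
  rw [Real.rpow_neg (by norm_num)]
  norm_num
  ring

lemma tauN_pow_four (N : ℕ) : tauN N ^ 4 = (N : ℝ) ^ (-(2 : ℝ) / 3) / 4 := by
  rw [tauN, mul_pow, ← Real.rpow_natCast, ← Real.rpow_natCast (_ ^ _), ← Real.rpow_mul (by norm_num),
    ← Real.rpow_mul (by positivity)]
  norm_num
  rw [Real.rpow_neg (by norm_num)]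
  norm_num
  ring

lemma abs_turning_point_slope_sub_one_le {N j : ℕ} (hN : N ≠ 0) (hjN : j ≤ N) (hNj : N ≤ j + 1) :
    |2 * √(2 * j + 1) * tauN N ^ 3 - 1| ≤ (1 : ℝ) / (2 * N) := by
  have hN0 : (0 : ℝ) < N := by positivity
  have hjN' : (j : ℝ) ≤ N := by exact_mod_cast hjN
  have hNj' : (N : ℝ) ≤ j + 1 := by exact_mod_cast hNj
  set κ := 2 * √(2 * j + 1) * tauN N ^ 3 with hκ
  have hκ0 : 0 ≤ κ := by rw [hκ, tauN]; positivity
  have h1 : κ ^ 2 - 1 = (2 * j + 1 - 2 * N) / (2 * N) := by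
    have : κ ^ 2 = 4 * √(2 * j + 1) ^ 2 * tauN N ^ 6 := by rw [hκ]; ring
    rw [this, tauN_pow_six hN, Real.sq_sqrt (by positivity)]
    field_simp
    ring
  have h2 : |κ ^ 2 - 1| ≤ (1 : ℝ) / (2 * N) := by
    rw [h1, abs_div, abs_of_pos (by positivity : (0 : ℝ) < 2 * N)]
    gcongr
    rw [abs_le]
    constructor <;> linarith
  refine le_trans ?_ h2
  rw [show κ ^ 2 - 1 = (κ - 1) * (κ + 1) by ring, abs_mul, abs_of_nonneg (by linarith : 0 ≤ κ + 1)]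
  exact le_mul_of_one_le_right (abs_nonneg _) (by linarith)

lemma one_div_le_rpow {N : ℕ} (hN : N ≠ 0) : (1 : ℝ) / N ≤ (N : ℝ) ^ (-(2 : ℝ) / 3) := by
  have hN1 : (1 : ℝ) ≤ N := by exact_mod_cast Nat.one_le_iff_ne_zero.2 hN
  rw [one_div, ← Real.rpow_neg_one]
  exact Real.rpow_le_rpow_of_exponent_le hN1 (by norm_num)

lemma exists_abs_osc_turning_point_sub_le :
    ∃ K > 0, ∀ N j : ℕ, 65 ≤ N → j ≤ N → N ≤ j + 1 →
      |(2 * N : ℝ) ^ ((1 : ℝ) / 4) * tauN N * osc j √(2 * j + 1) - Ai 0| ≤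
        K * (N : ℝ) ^ (-(2 : ℝ) / 3) := by
  obtain ⟨K, hK, h⟩ := exists_abs_edgeValue_sub_le
  refine ⟨2 * (|Ai 0| + K) + 2 * K, by positivity, fun N j hN hjN hNj => ?_⟩
  have hN0 : (0 : ℝ) < N := by
    have : 0 < N := by omega
    exact_mod_cast this
  have hNj' : (N : ℝ) ≤ j + 1 := by exact_mod_cast hNj
  have hj64 : (64 : ℝ) ≤ j := by
    have : 64 ≤ j := by omega
    exact_mod_cast this
  have hj0 : (0 : ℝ) < j := by linarith
  set D := (N : ℝ) ^ (-(2 : ℝ) / 3) with hD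
  have hm : (0 : ℝ) < (j : ℝ) + 1 / 2 := by linarith
  set r := ((j : ℝ) + 1 / 2) ^ (-(1 : ℝ) / 3) with hr
  have hr0 : 0 < r := by positivity
  have hr3 : ((j : ℝ) + 1 / 2) * r ^ 3 = 1 := by
    rw [hr, ← Real.rpow_natCast, ← Real.rpow_mul hm.le]
    norm_num
    rw [Real.rpow_neg_one, mul_inv_cancel₀ hm.ne']
  have hr4 : r ≤ 1 / 4 := by
    by_contra! hlt
    have h1 : (1 / 4 : ℝ) ^ 3 ≤ r ^ 3 := pow_le_pow_left₀ (by norm_num) hlt.le 3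
    nlinarith
  have hr2 : r ^ 2 ≤ 2 * D := by
    have h1 : r ^ 2 = ((j : ℝ) + 1 / 2) ^ (-(2 : ℝ) / 3) := by
      rw [hr, ← Real.rpow_natCast, ← Real.rpow_mul hm.le]
      norm_num
    have h2 : ((j : ℝ) + 1 / 2) ^ (-(2 : ℝ) / 3) ≤ ((N : ℝ) / 2) ^ (-(2 : ℝ) / 3) :=
      Real.rpow_le_rpow_of_nonpos (by positivity) (by linarith) (by norm_num)
    have h3 : ((N : ℝ) / 2) ^ (-(2 : ℝ) / 3) = D * 2 ^ ((2 : ℝ) / 3) := by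
      rw [Real.div_rpow hN0.le (by norm_num), neg_div, Real.rpow_neg (by norm_num : (0 : ℝ) ≤ 2),
        div_inv_eq_mul, hD, neg_div]
    have h4 : (2 : ℝ) ^ ((2 : ℝ) / 3) ≤ 2 ^ (1 : ℝ) :=
      Real.rpow_le_rpow_of_exponent_le (by norm_num) (by norm_num)
    rw [Real.rpow_one] at h4
    have hD0 : 0 ≤ D := by positivity
    rw [h1]
    nlinarith
  have hjD : (1 : ℝ) / j ≤ 2 * D := by
    have h1 := one_div_le_rpow (N := N) (by omega)
    have h2 : (1 : ℝ) / j ≤ 2 * (1 / N) := by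
      rw [mul_one_div, div_le_div_iff₀ hj0 hN0]
      linarith
    linarith
  have he := h j r hr0 hr4 hr3
  have hF := (abs_edgeFactor_sub_one_le (by rintro rfl; norm_num at hj64) hjN hNj).trans hjD
  rw [osc_turning_point, ← hr]
  set e := edgeValue j r
  have he2 : |e| ≤ |Ai 0| + K := by
    have h1 : |e| ≤ |e - Ai 0| + |Ai 0| := by
      simpa using abs_add_le (e - Ai 0) (Ai 0)
    have h2 : K * r ^ 2 ≤ K * 1 := by
      gcongr
      nlinarith
    linarith
  calc |edgeFactor N j * e - Ai 0| = |(edgeFactor N j - 1) * e + (e - Ai 0)| := by ring_nf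
    _ ≤ |edgeFactor N j - 1| * |e| + |e - Ai 0| := by
      rw [← abs_mul]; exact abs_add_le _ _
    _ ≤ 2 * D * (|Ai 0| + K) + K * (2 * D) := by
      refine add_le_add (by gcongr) (he.trans (by gcongr))
    _ = _ := by ring

lemma tendsto_zero_of_abs_le_exp {y : ℝ → ℝ} {K : ℝ} (h : ∀ x, |y x| ≤ K * Real.exp (-x)) :
    Tendsto y atTop (𝓝 0) := by
  refine squeeze_zero_norm h ?_
  simpa using tendsto_const_mul_exp K one_pos

lemma tendsto_turning_point_comp {N : ℕ} (hN : N ≠ 0) (u : ℝ) :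
    Tendsto (fun s => u + s * tauN N) atTop atTop := by
  have hτ : 0 < tauN N := by
    rw [tauN]
    positivity
  exact tendsto_atTop_add_const_left _ _ (tendsto_id.atTop_mul_const hτ)

lemma hasDerivAt_rescaled_osc (N j : ℕ) (s : ℝ) :
    HasDerivAt (fun s => (2 * N : ℝ) ^ ((1 : ℝ) / 4) * tauN N * osc j (√(2 * j + 1) + s * tauN N))
      ((2 * N : ℝ) ^ ((1 : ℝ) / 4) * tauN N ^ 2 * oscDeriv j (√(2 * j + 1) + s * tauN N)) s := by
  have h := ((hasDerivAt_osc j (√(2 * j + 1) + s * tauN N)).comp s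
    (((hasDerivAt_id s).mul_const (tauN N)).const_add √(2 * j + 1))).const_mul
    ((2 * N : ℝ) ^ ((1 : ℝ) / 4) * tauN N)
  exact h.congr_deriv (by ring)

lemma hasDerivAt_rescaled_oscDeriv (N j : ℕ) (s : ℝ) :
    HasDerivAt
      (fun s => (2 * N : ℝ) ^ ((1 : ℝ) / 4) * tauN N ^ 2 * oscDeriv j (√(2 * j + 1) + s * tauN N))
      ((2 * √(2 * j + 1) * tauN N ^ 3 * s + tauN N ^ 4 * s ^ 2) *
        ((2 * N : ℝ) ^ ((1 : ℝ) / 4) * tauN N * osc j (√(2 * j + 1) + s * tauN N))) s := by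
  have h := ((hasDerivAt_oscDeriv j (√(2 * j + 1) + s * tauN N)).comp s
    (((hasDerivAt_id s).mul_const (tauN N)).const_add √(2 * j + 1))).const_mul
    ((2 * N : ℝ) ^ ((1 : ℝ) / 4) * tauN N ^ 2)
  refine h.congr_deriv ?_
  have hu : √(2 * j + 1 : ℝ) ^ 2 = 2 * j + 1 := Real.sq_sqrt (by positivity)
  linear_combination (2 * N : ℝ) ^ ((1 : ℝ) / 4) * tauN N ^ 3 *
    osc j (√(2 * j + 1) + s * tauN N) * hu

/-- Bounds for the derivative of the rescaled oscillator wave functions: for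
`j ∈ {N-1, N}`, `u_j = √(2j+1)`, both `|(2N)^{1/4} τ_N² φ_j'(u_j + s τ_N)| ≤ C e^{-s}` and
`|(2N)^{1/4} τ_N² φ_j'(u_j + s τ_N) - Ai'(s)| ≤ C N^{-2/3} e^{-s/2}` for all `s ≥ s_L`. -/
theorem rescaled_osc_deriv_bounds (sL : ℝ) :
    ∃ C > 0, ∃ N₀ : ℕ, ∀ N : ℕ, N₀ ≤ N → ∀ j ∈ ({N - 1, N} : Set ℕ), ∀ s : ℝ, sL ≤ s →
      |(2 * N : ℝ) ^ ((1 : ℝ) / 4) * tauN N ^ 2 *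
          deriv (osc j) (Real.sqrt (2 * j + 1) + s * tauN N)| ≤ C * Real.exp (-s) ∧
      |(2 * N : ℝ) ^ ((1 : ℝ) / 4) * tauN N ^ 2 *
          deriv (osc j) (Real.sqrt (2 * j + 1) + s * tauN N) - deriv Ai s| ≤
        C * (N : ℝ) ^ (-(2 : ℝ) / 3) * Real.exp (-s / 2) := by
  obtain ⟨K, hK, hturn⟩ := exists_abs_osc_turning_point_sub_le
  obtain ⟨C, hC, hcomp⟩ := exists_perturbedAiry_bounds (M := |Ai 0| + K) (by positivity)
    (abs_nonneg sL)
  refine ⟨C * (K + 1), by positivity, 65, fun N hN j hj s hs => ?_⟩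
  have hN' : N ≠ 0 := by omega
  have hjN : j ≤ N ∧ N ≤ j + 1 := by
    rcases hj with rfl | rfl <;> omega
  have hN1 : (1 : ℝ) ≤ N := by exact_mod_cast Nat.one_le_iff_ne_zero.2 hN'
  set D := (N : ℝ) ^ (-(2 : ℝ) / 3) with hD
  have hD0 : 0 < D := by positivity
  have hD1 : D ≤ 1 := Real.rpow_le_one_of_one_le_of_nonpos hN1 (by norm_num)
  have hslope := abs_turning_point_slope_sub_one_le hN' hjN.1 hjN.2
  have hND : (1 : ℝ) / (2 * N) ≤ D / 2 := by
    have := one_div_le_rpow hN'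
    rw [mul_comm, ← div_div]
    linarith
  have h0 := hturn N j hN hjN.1 hjN.2
  rw [← hD] at h0
  have hKD : K * D ≤ (K + 1) * D := by gcongr; linarith
  have hKD1 : K * D ≤ K := mul_le_of_le_one_right hK.le hD1
  have hDK : D ≤ (K + 1) * D := le_mul_of_one_le_left hD0.le (by linarith)
  have h4 := tauN_pow_four N
  rw [← hD] at h4
  have hb := abs_le.1 (hslope.trans hND)
  obtain ⟨KA, -, hKA⟩ := exists_abs_Ai_le
  obtain ⟨KA', -, hKA'⟩ := exists_abs_AiDeriv_le
  have hlim := tendsto_turning_point_comp hN' √(2 * (j : ℝ) + 1)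
  have hscale : ∀ (c : ℝ) {y : ℝ → ℝ}, Tendsto y atTop (𝓝 0) →
      Tendsto (fun s => c * y s) atTop (𝓝 0) := fun c y hy => by simpa using hy.const_mul c
  have key := hcomp (δ := (K + 1) * D) (by linarith [hb.1]) (by linarith [hb.2])
    (by positivity : 0 ≤ tauN N ^ 4) (by linarith) ((hslope.trans hND).trans (by linarith))
    (by linarith) (hasDerivAt_rescaled_osc N j) (hasDerivAt_rescaled_oscDeriv N j)
    (hscale _ ((tendsto_osc j).comp hlim)) (hscale _ ((tendsto_oscDeriv j).comp hlim))
    (by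
      rw [zero_mul, add_zero]
      have := abs_sub_abs_le_abs_sub
        ((2 * N : ℝ) ^ ((1 : ℝ) / 4) * tauN N * osc j √(2 * j + 1)) (Ai 0)
      linarith)
    hasDerivAt_Ai hasDerivAt_AiDeriv (tendsto_zero_of_abs_le_exp hKA)
    (tendsto_zero_of_abs_le_exp hKA')
    (by
      rw [zero_mul, add_zero]
      exact h0.trans hKD) s ((neg_abs_le sL).trans hs)
  rw [(hasDerivAt_osc j _).deriv, (hasDerivAt_Ai s).deriv]
  refine ⟨key.1.trans ?_, key.2.trans (le_of_eq (by ring))⟩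
  gcongr
  exact le_mul_of_one_le_right hC.le (by linarith)
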